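/- arXiv:1605.01349 — 3 statements merged into one kernel-verified Lean document; each statement's English description precedes it below -/
import Mathlib

section
/- Let q ∈ (0,1), s ∈ (−1,0), n ≥ 1, and let u₁,…,u_n be pairwise distinct positive reals with u_i ≠ q·u_j for all i, j. Fix r > q^{−1}, an integer ℓ ≥ 1, and integers x₁ ≥ x₂ ≥ … ≥ x_ℓ ≥ 1. Then there exist δ₀, ρ₀ > 0 such that for all δ ∈ (0,δ₀) and ρ ∈ (0,ρ₀) the multi-point q-moments of the height function satisfy: Σ_{ν ∈ Sign⁺_n} M_{u;ρ}(ν) · ∏_{i=1}^ℓ q^{h_ν(x_i)} = q^{ℓ(ℓ−1)/2} · (2πi)^{−ℓ} ∮_{γ[ū|1]} ⋯ ∮_{γ[ū|ℓ]} ∏_{1≤α<β≤ℓ} (w_α−w_β)/(w_α−qw_β) · ∏_{i=1}^ℓ [ w_i^{−1} · ((1−s w_i)/(1−s^{−1} w_i))^{x_i−1} · ∏_{j=1}^n (1−q u_j w_i)/(1−u_j w_i) ] dw₁⋯dw_ℓ, where the series on the left converges absolutely, γ[ū|j] is the union of the positively oriented circles of radius δ centered at u₁^{−1},…,u_n^{−1}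 together with the positively oriented circle of radius r^j·ρ centered at 0 (the variable w_j is integrated over γ[ū|j], and an integral over a union of circles means the sum of the corresponding circle integrals). -/
open Finset

noncomputable section

/-- The finite q-Pochhammer symbol `(a;q)_m = ∏_{i=0}^{m-1} (1 - a q^i)`. -/
def qPoch {K : Type*} [CommRing K] (a q : K) (m : ℕ) : K :=
  ∏ i ∈ Finset.range m, (1 - a * q ^ i)

/-- Signatures of length `n`: weakly decreasing tuples of nonnegative integers. -/
abbrev Sign (n : ℕ) : Type :=
  {ν : Fin n → ℕ // ∀ i j : Fin n, i ≤ j → ν j ≤ ν i}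

/-- The symmetric rational function `F_μ(u₁,…,u_M)` (symmetrization formula (4.20)). -/
def Ffun (q s : ℂ) {M : ℕ} (μ : Fin M → ℕ) (u : Fin M → ℂ) : ℂ :=
  ((1 - q) ^ M / ∏ i, (1 - s * u i)) *
    ∑ σ : Equiv.Perm (Fin M),
      (∏ p ∈ (Finset.univ : Finset (Fin M × Fin M)).filter (fun p => p.1 < p.2),
        (u (σ p.1) - q * u (σ p.2)) / (u (σ p.1) - u (σ p.2))) *
      ∏ i, ((u (σ i) - s) / (1 - s * u (σ i))) ^ (μ i)

/-- Multiplicity of the value `k` among the parts of `lam`. -/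
def mult {n : ℕ} (lam : Fin n → ℕ) (k : ℕ) : ℕ :=
  ((Finset.univ : Finset (Fin n)).filter (fun i => lam i = k)).card

/-- The conjugation constant `c(λ) = ∏_{k≥0} (s²;q)_{m_k}/(q;q)_{m_k}`. -/
def cconst (q s : ℂ) {n : ℕ} (lam : Fin n → ℕ) : ℂ :=
  ∏ᶠ k : ℕ, qPoch (s ^ 2) q (mult lam k) / qPoch q q (mult lam k)

/-- `F^c_λ = c(λ)·F_λ`. -/
def Fc (q s : ℂ) {M : ℕ} (μ : Fin M → ℕ) (u : Fin M → ℂ) : ℂ :=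
  cconst q s μ * Ffun q s μ u

/-- The symmetric rational function `G_ν(v₁,…,v_N)` (symmetrization formula (4.21)). -/
def Gfun (q s : ℂ) {n N : ℕ} (ν : Fin n → ℕ) (v : Fin N → ℂ) : ℂ :=
  if h : n - mult ν 0 ≤ N then
    (qPoch (s ^ 2) q n / (qPoch q q (N - (n - mult ν 0)) * qPoch (s ^ 2) q (mult ν 0))) *
      ((1 - q) ^ N / ∏ j, (1 - s * v j)) *
      ∑ σ : Equiv.Perm (Fin N),
        (∏ p ∈ (Finset.univ : Finset (Fin N × Fin N)).filter (fun p => p.1 < p.2),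
          (v (σ p.1) - q * v (σ p.2)) / (v (σ p.1) - v (σ p.2))) *
        (∏ j : Fin (n - mult ν 0),
          ((v (σ (Fin.castLE h j)) - s) / (1 - s * v (σ (Fin.castLE h j)))) ^
            (ν (Fin.castLE (Nat.sub_le n (mult ν 0)) j))) *
        (∏ i : Fin (n - mult ν 0), v (σ (Fin.castLE h i)) / (v (σ (Fin.castLE h i)) - s)) *
        (∏ j ∈ (Finset.univ : Finset (Fin N)).filter (fun j : Fin N => n - mult ν 0 ≤ (j : ℕ)),
          (1 - s * q ^ (mult ν 0) * v (σ j)))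
  else 0

/-- Iterated integral: `iterInt k ops f` applies the integration functional `ops i` to the
`i`-th variable (outermost first). -/
def iterInt : (k : ℕ) → (Fin k → ((ℂ → ℂ) → ℂ)) → ((Fin k → ℂ) → ℂ) → ℂ
  | 0, _, f => f Fin.elim0
  | k + 1, ops, f => ops 0 (fun z => iterInt k (fun i => ops i.succ) (fun u => f (Fin.cons z u)))

/-- The weight `M_{u;ρ}(ν) = 1_{ν_n ≥ 1}·(−s)^{|ν|−n}·F^c_{ν−1^n}(u)` of the stochastic higher
spin six vertex model at time `n`, started from the empty configuration. -/
def Mwt (q s : ℂ) {n : ℕ} (u : Fin n → ℂ) (ν : Fin n → ℕ) : ℂ :=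
  (if ∀ i, 1 ≤ ν i then (1 : ℂ) else 0) * (-s) ^ (∑ i, ν i - n) *
    Fc q s (fun i => ν i - 1) u

/-- The height function `h_ν(x) = #{j : ν_j ≥ x}`. -/
def height {n : ℕ} (ν : Fin n → ℕ) (x : ℕ) : ℕ :=
  ((Finset.univ : Finset (Fin n)).filter (fun j => x ≤ ν j)).card

/-- The two-body factor `(u_a - q u_b) / (u_a - u_b)`. -/
def scat (q : ℂ) {ι : Type*} (u : ι → ℂ) (a b : ι) : ℂ :=
  (u a - q * u b) / (u a - u b)

theorem qPoch_succ_left {K : Type*} [CommRing K] (a q : K) (m : ℕ) :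
    qPoch a q (m + 1) = (1 - a) * qPoch (q * a) q m := by
  unfold qPoch
  rw [Finset.prod_range_succ', mul_comm]
  congr 1
  · simp
  · refine Finset.prod_congr rfl fun i _ => ?_
    ring

theorem one_sub_mul_sum_prod_scat {ι : Type*} [DecidableEq ι] (q : ℂ) (u : ι → ℂ)
    (hu : Function.Injective u) (hu0 : ∀ a, u a ≠ 0) (I : Finset ι) :
    (1 - q) * ∑ a ∈ I, ∏ b ∈ I.erase a, scat q u a b = 1 - q ^ #I := by
  classical
  let v : Option ι → ℂ := fun o => o.elim 0 u
  have hv : Function.Injective v := by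
    rintro (_ | a) (_ | b) h
    · rfl
    · exact absurd h.symm (hu0 b)
    · exact absurd h (hu0 a)
    · exact congrArg some (hu h)
  let P : Polynomial ℂ := ∏ k ∈ I, (Polynomial.X - Polynomial.C (q * u k))
  have hPm : P.Monic := Polynomial.monic_prod_X_sub_C _ _
  have hdeg : P.degree = #I := by
    rw [Polynomial.degree_eq_natDegree hPm.ne_zero]
    rw [Polynomial.natDegree_finsetProd_X_sub_C_eq_card]
  have key := Lagrange.leadingCoeff_eq_sum (s := Finset.insertNone I) (v := v)
    hv.injOn (P := P) (by rw [hdeg]; simp)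
  rw [hPm.leadingCoeff, Finset.sum_insertNone] at key
  have e1 : (Finset.insertNone I).erase none = I.map Function.Embedding.some := by
    ext (_ | a) <;> simp
  have e2 : ∀ a, (Finset.insertNone I).erase (some a) = Finset.insertNone (I.erase a) := by
    intro a
    ext (_ | b) <;> simp
  have h0 : Polynomial.eval (v none) P / ∏ j ∈ (Finset.insertNone I).erase none, (v none - v j)
      = q ^ #I := by
    rw [e1, Finset.prod_map, Polynomial.eval_prod, ← Finset.prod_div_distrib,
      ← Finset.prod_const]
    refine Finset.prod_congr rfl fun a _ => ?_
    have := hu0 a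
    simp [v]
    field_simp
  rw [h0] at key
  have h1 : ∀ a ∈ I, Polynomial.eval (v (some a)) P /
      ∏ j ∈ (Finset.insertNone I).erase (some a), (v (some a) - v j)
      = (1 - q) * ∏ b ∈ I.erase a, scat q u a b := by
    intro a ha
    rw [e2, Finset.prod_insertNone, Polynomial.eval_prod, ← Finset.mul_prod_erase _ _ ha,
      mul_div_mul_comm, ← Finset.prod_div_distrib]
    have := hu0 a
    congr 1
    · simp [v]
      field_simp
    · simp [v, scat]
  rw [Finset.sum_congr rfl h1, ← Finset.mul_sum] at key
  linear_combination -key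

theorem sum_powerset_qPoch_mul_scat {ι : Type*} [DecidableEq ι] (q : ℂ) (v : ι → ℂ)
    (hv : Function.Injective v) (hv1 : ∀ a, v a ≠ 1) (I : Finset ι) (T : ℂ) :
    ∑ J ∈ I.powerset, qPoch T q #(I \ J) * (∏ a ∈ J, (T - v a)) *
      ∏ a ∈ J, ∏ b ∈ I \ J, scat q v a b = ∏ a ∈ I, (1 - v a) := by
  classical
  induction I using Finset.strongInduction generalizing T with
  | H I ih =>
    let P : Polynomial ℂ := ∑ J ∈ I.powerset,
      qPoch Polynomial.X (Polynomial.C q) #(I \ J) *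
        (∏ a ∈ J, (Polynomial.X - Polynomial.C (v a))) *
        Polynomial.C (∏ a ∈ J, ∏ b ∈ I \ J, scat q v a b)
    have hq : ∀ (x : ℂ) (m : ℕ),
        (qPoch Polynomial.X (Polynomial.C q) m).eval x = qPoch x q m := by
      intro x m
      simp [qPoch, Polynomial.eval_prod]
    have heval : ∀ x, P.eval x = ∑ J ∈ I.powerset, qPoch x q #(I \ J) *
        (∏ a ∈ J, (x - v a)) * ∏ a ∈ J, ∏ b ∈ I \ J, scat q v a b := by
      intro x
      simp only [P, Polynomial.eval_finsetSum, Polynomial.eval_mul, hq, Polynomial.eval_C,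
        Polynomial.eval_prod, Polynomial.eval_sub, Polynomial.eval_X]
    have hqd : ∀ m : ℕ,
        (qPoch Polynomial.X (Polynomial.C q) m : Polynomial ℂ).natDegree ≤ m := by
      intro m
      refine (Polynomial.natDegree_prod_le _ _).trans ?_
      refine (Finset.sum_le_card_nsmul _ _ 1 fun i _ => ?_).trans (by simp)
      rw [← Polynomial.C_pow, ← Polynomial.C_1]
      compute_degree
    have hdeg : P.degree < ((#I + 1 : ℕ) : WithBot ℕ) := by
      refine (Polynomial.degree_le_natDegree).trans_lt ?_
      rw [Nat.cast_lt, Nat.lt_succ_iff]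
      refine Polynomial.natDegree_sum_le_of_forall_le _ _ fun J hJ => ?_
      rw [Finset.mem_powerset] at hJ
      refine (Polynomial.natDegree_mul_C_le _ _).trans ?_
      refine (Polynomial.natDegree_mul_le).trans ?_
      have h2 := hqd #(I \ J)
      rw [Polynomial.natDegree_finsetProd_X_sub_C_eq_card]
      have := Finset.card_sdiff_add_card_eq_card hJ
      omega
    have hcard : #(insert 1 (I.image v)) = #I + 1 := by
      rw [Finset.card_insert_of_notMem, Finset.card_image_of_injective _ hv]
      simp [hv1]
    have hP : P = Polynomial.C (∏ a ∈ I, (1 - v a)) := by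
      refine Polynomial.eq_of_degrees_lt_of_eval_finset_eq (insert 1 (I.image v))
        (by rwa [hcard]) ?_ ?_
      · rw [hcard]
        exact Polynomial.degree_C_le.trans_lt (by norm_cast; omega)
      · intro x hx
        rw [heval, Polynomial.eval_C]
        rw [Finset.mem_insert, Finset.mem_image] at hx
        rcases hx with rfl | ⟨i, hi, rfl⟩
        · rw [Finset.sum_eq_single I]
          · simp [qPoch]
          · intro J hJ hne
            have : #(I \ J) ≠ 0 := by
              rw [Finset.card_ne_zero, Finset.sdiff_nonempty]
              intro h
              exact hne ((Finset.mem_powerset.1 hJ).antisymm h)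
            obtain ⟨m, hm⟩ := Nat.exists_eq_succ_of_ne_zero this
            rw [hm, Nat.succ_eq_add_one, qPoch_succ_left]
            simp
          · simp
        · rw [← Finset.mul_prod_erase _ _ hi, ← ih _ (Finset.erase_ssubset hi) (q * v i),
            Finset.mul_sum]
          symm
          refine Finset.sum_subset_zero_on_sdiff
            (Finset.powerset_mono.2 (Finset.erase_subset i I)) ?_ ?_
          · intro J hJ
            have hiJ : i ∈ J := by
              by_contra h
              simp only [Finset.mem_sdiff, Finset.mem_powerset] at hJ
              exact hJ.2 (fun a ha => Finset.mem_erase.2 ⟨fun e => h (e ▸ ha), hJ.1 ha⟩)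
            rw [Finset.prod_eq_zero hiJ (sub_self _)]
            simp
          · intro J hJ
            rw [Finset.mem_powerset] at hJ
            have hiJ : i ∉ J := fun h => by simpa using hJ h
            have hset : I \ J = insert i (I.erase i \ J) := by
              ext a
              simp only [Finset.mem_sdiff, Finset.mem_insert, Finset.mem_erase]
              by_cases h : a = i
              · subst h; simp [hi, hiJ]
              · simp [h]
            have hni : i ∉ I.erase i \ J := by simp
            rw [hset, Finset.card_insert_of_notMem hni, qPoch_succ_left]
            have : ∏ a ∈ J, ∏ b ∈ insert i (I.erase i \ J), scat q v a b
                = (∏ a ∈ J, scat q v a i) * ∏ a ∈ J, ∏ b ∈ I.erase i \ J, scat q v a b := by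
              rw [← Finset.prod_mul_distrib]
              refine Finset.prod_congr rfl fun a _ => ?_
              rw [Finset.prod_insert hni]
            rw [this]
            have h3 : ∏ a ∈ J, (q * v i - v a)
                = (∏ a ∈ J, (v i - v a)) * ∏ a ∈ J, scat q v a i := by
              rw [← Finset.prod_mul_distrib]
              refine Finset.prod_congr rfl fun a ha => ?_
              have : v a - v i ≠ 0 :=
                sub_ne_zero.2 fun e => hiJ (hv e ▸ ha)
              unfold scat
              field_simp
              ring
            rw [h3]
            ring
    rw [← heval, hP, Polynomial.eval_C]

/-- The geometric ratio `-s (u_a - s) / (1 - s u_a)`, in expanded form. -/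
def jumpRatio (s : ℂ) {ι : Type*} (u : ι → ℂ) (a : ι) : ℂ :=
  (s ^ 2 - s * u a) / (1 - s * u a)

/-- The residue expansion of the nested contour integral, with the variables indexed by `I`. -/
def residueSum (q s : ℂ) {ι : Type*} [DecidableEq ι] (u : ι → ℂ) :
    (l : ℕ) → (Fin l → ℕ) → Finset ι → ℂ
  | 0, _, _ => 1
  | l + 1, y, I => residueSum q s u l (Fin.tail y) I -
      (1 - q) * q ^ l * ∑ j ∈ I, jumpRatio s u j ^ (y 0) *
        (∏ b ∈ I.erase j, scat q u j b) * residueSum q s u l (Fin.tail y) (I.erase j)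

/-- The weight of the transition from the set `I` of particles to the right of a column to the
set `J` of those to the right of the next column. -/
def columnWeight (q s : ℂ) {ι : Type*} [DecidableEq ι] (u : ι → ℂ) (I J : Finset ι) : ℂ :=
  qPoch (s ^ 2) q #(I \ J) * (∏ b ∈ I \ J, (1 - s * u b)⁻¹) * (∏ a ∈ J, jumpRatio s u a) *
    ∏ a ∈ J, ∏ b ∈ I \ J, scat q u a b

theorem sum_columnWeight {ι : Type*} [DecidableEq ι] (q s : ℂ) (hs : s ≠ 0) (u : ι → ℂ)
    (hu : Function.Injective u) (hsu : ∀ a, 1 - s * u a ≠ 0) (I : Finset ι) :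
    ∑ J ∈ I.powerset, columnWeight q s u I J = 1 := by
  have key := sum_powerset_qPoch_mul_scat q (fun a => s * u a)
    (fun a b h => hu (mul_left_cancel₀ hs h)) (fun a h => hsu a (by simp [h])) I (s ^ 2)
  have hprod : ∏ a ∈ I, (1 - s * u a) ≠ 0 := Finset.prod_ne_zero_iff.2 fun a _ => hsu a
  rw [← mul_right_inj' hprod, mul_one]
  conv_rhs => rw [← key]
  rw [Finset.mul_sum]
  refine Finset.sum_congr rfl fun J hJ => ?_
  rw [Finset.mem_powerset] at hJ
  have hB : ∀ a b, scat q (fun a => s * u a) a b = scat q u a b := by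
    intro a b
    unfold scat
    rw [← mul_div_mul_left (u a - q * u b) (u a - u b) hs]
    ring_nf
  simp only [hB]
  unfold columnWeight jumpRatio
  rw [← Finset.prod_sdiff hJ, Finset.prod_div_distrib, Finset.prod_inv_distrib]
  have h1 : ∏ a ∈ J, (1 - s * u a) ≠ 0 := Finset.prod_ne_zero_iff.2 fun a _ => hsu a
  have h2 : ∏ a ∈ I \ J, (1 - s * u a) ≠ 0 := Finset.prod_ne_zero_iff.2 fun a _ => hsu a
  field_simp

theorem columnWeight_mul_prod_scat {ι : Type*} [DecidableEq ι] (q s : ℂ) (u : ι → ℂ)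
    {I J : Finset ι} {j : ι} (hJ : J ⊆ I) (hj : j ∈ J) :
    columnWeight q s u I J * ∏ b ∈ J.erase j, scat q u j b =
      jumpRatio s u j * (∏ b ∈ I.erase j, scat q u j b) *
        columnWeight q s u (I.erase j) (J.erase j) := by
  have h1 : I.erase j \ J.erase j = I \ J := by
    ext a
    simp only [Finset.mem_sdiff, Finset.mem_erase]
    by_cases h : a = j
    · subst h; simp [hj]
    · simp [h]
  have h2 : ∏ b ∈ I.erase j, scat q u j b
      = (∏ b ∈ I \ J, scat q u j b) * ∏ b ∈ J.erase j, scat q u j b := by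
    rw [← Finset.prod_sdiff (Finset.erase_subset_erase j hJ), h1]
  unfold columnWeight
  rw [h1, h2, ← Finset.mul_prod_erase J (jumpRatio s u) hj,
    ← Finset.mul_prod_erase J (fun a => ∏ b ∈ I \ J, scat q u a b) hj]
  ring

theorem residueSum_add_one {ι : Type*} [DecidableEq ι] (q s : ℂ) (hs : s ≠ 0) (u : ι → ℂ)
    (hu : Function.Injective u) (hsu : ∀ a, 1 - s * u a ≠ 0) (l : ℕ) (y : Fin l → ℕ)
    (I : Finset ι) :
    residueSum q s u l (fun i => y i + 1) I =
      ∑ J ∈ I.powerset, columnWeight q s u I J * residueSum q s u l y J := by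
  induction l generalizing I with
  | zero => simp [residueSum, sum_columnWeight q s hs u hu hsu]
  | succ l ih =>
    have htail : Fin.tail (fun i => y i + 1) = fun i => Fin.tail y i + 1 := rfl
    simp only [residueSum, htail, ih, mul_sub, Finset.sum_sub_distrib]
    congr 1
    have : ∀ J : Finset ι, ∀ f : ι → ℂ, columnWeight q s u I J * ((1 - q) * q ^ l * ∑ j ∈ J, f j)
        = (1 - q) * q ^ l * ∑ j ∈ J, columnWeight q s u I J * f j := by
      intro J f
      rw [← Finset.mul_sum]
      ring
    simp only [this, ← Finset.mul_sum]
    congr 1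
    simp only [Finset.mul_sum (_ : Finset ι) _ (columnWeight q s u I _)]
    rw [Finset.sum_comm' (s := I.powerset) (t := fun J => J) (t' := I)
      (s' := fun j => I.powerset.filter (fun J => j ∈ J))]
    · refine Finset.sum_congr rfl fun j hj => ?_
      rw [Finset.mul_sum]
      refine Finset.sum_nbij' (fun J => insert j J) (fun J => J.erase j) ?_ ?_ ?_ ?_ ?_
      · intro J hJ
        simp only [Finset.mem_filter, Finset.mem_powerset] at hJ ⊢
        exact ⟨Finset.insert_subset hj (hJ.trans (Finset.erase_subset _ _)),
          Finset.mem_insert_self _ _⟩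
      · intro J hJ
        simp only [Finset.mem_filter, Finset.mem_powerset] at hJ ⊢
        exact Finset.erase_subset_erase j hJ.1
      · intro J hJ
        rw [Finset.mem_powerset] at hJ
        exact Finset.erase_insert fun h => by simpa using hJ h
      · intro J hJ
        exact Finset.insert_erase (Finset.mem_filter.1 hJ).2
      · intro J hJ
        rw [Finset.mem_powerset] at hJ
        have hjJ : j ∉ J := fun h => by simpa using hJ h
        have key := columnWeight_mul_prod_scat q s u (J := insert j J) (I := I) (j := j)
          (Finset.insert_subset hj (hJ.trans (Finset.erase_subset _ _)))
          (Finset.mem_insert_self _ _)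
        rw [Finset.erase_insert hjJ] at key
        rw [Finset.erase_insert hjJ]
        rw [pow_succ]
        linear_combination (-(jumpRatio s u j ^ (y 0)) * residueSum q s u l (Fin.tail y) J) * key
    · intro J j
      simp only [Finset.mem_powerset, Finset.mem_filter]
      exact ⟨fun h => ⟨⟨h.1, h.2⟩, h.1 h.2⟩, fun h => ⟨h.1.1, h.1.2⟩⟩

theorem residueSum_last_eq_zero {ι : Type*} [DecidableEq ι] (q s : ℂ) (u : ι → ℂ)
    (hu : Function.Injective u) (hu0 : ∀ a, u a ≠ 0) (l : ℕ) (y : Fin (l + 1) → ℕ)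
    (hy : y (Fin.last l) = 0) (I : Finset ι) :
    residueSum q s u (l + 1) y I = q ^ #I * residueSum q s u l (Fin.init y) I := by
  induction l generalizing I with
  | zero =>
    have hy0 : y 0 = 0 := hy
    have := one_sub_mul_sum_prod_scat q u hu hu0 I
    simp only [residueSum, hy0, pow_zero, mul_one, one_mul]
    linear_combination -this
  | succ l ih =>
    have hlast : Fin.tail y (Fin.last l) = 0 := hy
    rw [residueSum, ih _ hlast]
    conv_rhs => rw [residueSum]
    have : Fin.init y 0 = y 0 := rfl
    rw [Fin.tail_init_eq_init_tail, this]
    rw [mul_sub, Finset.mul_sum, Finset.mul_sum, Finset.mul_sum]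
    congr 1
    refine Finset.sum_congr rfl fun j hj => ?_
    rw [ih _ hlast, ← Finset.card_erase_add_one hj]
    ring

theorem mult_eq_zero {n : ℕ} {f : Fin n → ℕ} {k : ℕ} (h : ∀ a, f a ≠ k) : mult f k = 0 := by
  simp [mult, h]

theorem finprod_mult {n : ℕ} (h : ℕ → ℂ) (h0 : h 0 = 1) (f : Fin n → ℕ) (N : ℕ)
    (hN : ∀ a, f a < N) : ∏ᶠ k, h (mult f k) = ∏ k ∈ Finset.range N, h (mult f k) := by
  refine finprod_eq_prod_of_mulSupport_subset _ fun k hk => ?_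
  rw [Finset.coe_range, Set.mem_Iio]
  by_contra hk'
  refine hk ?_
  change h (mult f k) = 1
  rw [mult_eq_zero, h0]
  intro a e
  have := hN a
  omega

theorem finprod_mult_succ {n : ℕ} (h : ℕ → ℂ) (h0 : h 0 = 1) (f : Fin n → ℕ) (N : ℕ)
    (hN : ∀ a, f a ≤ N) :
    ∏ᶠ k, h (mult f (k + 1)) = ∏ k ∈ Finset.range N, h (mult f (k + 1)) := by
  refine finprod_eq_prod_of_mulSupport_subset _ fun k hk => ?_
  rw [Finset.coe_range, Set.mem_Iio]
  by_contra hk'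
  refine hk ?_
  change h (mult f (k + 1)) = 1
  rw [mult_eq_zero, h0]
  intro a e
  have := hN a
  omega

/-- The particles of a configuration to the right of the origin. -/
def posSet {n : ℕ} (f : Fin n → ℕ) : Finset (Fin n) := Finset.univ.filter fun a => 0 < f a

theorem mem_posSet {n : ℕ} {f : Fin n → ℕ} {a : Fin n} : a ∈ posSet f ↔ 0 < f a := by
  simp [posSet]

/-- The (signed) weight of a configuration of labelled particles. -/
def configWeight (q s : ℂ) {n : ℕ} (u : Fin n → ℂ) (f : Fin n → ℕ) : ℂ :=
  (∏ᶠ k, qPoch (s ^ 2) q (mult f (k + 1))) *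
    (∏ a ∈ posSet f, (1 - s * u a)⁻¹ * jumpRatio s u a ^ (f a - 1)) *
    ∏ p ∈ (Finset.univ : Finset (Fin n × Fin n)).filter (fun p => f p.2 < f p.1 ∧ 0 < f p.2),
      scat q u p.1 p.2

/-- Move the particles in `I` one step to the right. -/
def shiftOn {n : ℕ} (I : Finset (Fin n)) (g : Fin n → ℕ) : Fin n → ℕ :=
  fun a => g a + if a ∈ I then 1 else 0

theorem shiftOn_injective {n : ℕ} (I : Finset (Fin n)) : Function.Injective (shiftOn I) := by
  intro g g' h
  funext a
  exact Nat.add_right_cancel (congrFun h a)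

theorem posSet_shiftOn {n : ℕ} (I : Finset (Fin n)) (g : Fin n → ℕ) :
    posSet (shiftOn I g) = I ↔ posSet g ⊆ I := by
  constructor
  · intro h a ha
    rw [← h, mem_posSet]
    rw [mem_posSet] at ha
    exact Nat.add_pos_left ha _
  · intro h
    ext a
    have := @h a
    rw [mem_posSet] at this ⊢
    unfold shiftOn
    by_cases ha : a ∈ I
    · simp [ha]
    · simp only [ha, imp_false, not_lt, if_false] at this ⊢
      simp [Nat.le_zero.1 this]

theorem configWeight_shiftOn (q s : ℂ) {n : ℕ} (u : Fin n → ℂ) (I : Finset (Fin n))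
    (g : Fin n → ℕ) (hg : posSet g ⊆ I) :
    configWeight q s u (shiftOn I g) =
      columnWeight q s u I (posSet g) * configWeight q s u g := by
  have hpos : posSet (shiftOn I g) = I := (posSet_shiftOn I g).2 hg
  have hg' : ∀ a, a ∉ I → g a = 0 := fun a ha =>
    Nat.eq_zero_of_not_pos fun h => ha (hg (mem_posSet.2 h))
  have h0 : qPoch (s ^ 2) q 0 = 1 := by simp [qPoch]
  have e1 : ∏ᶠ k, qPoch (s ^ 2) q (mult (shiftOn I g) (k + 1)) =
      qPoch (s ^ 2) q #(I \ posSet g) * ∏ᶠ k, qPoch (s ^ 2) q (mult g (k + 1)) := by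
    have hN : ∀ a, g a ≤ ∑ a, g a := fun a =>
      Finset.single_le_sum (f := g) (fun _ _ => Nat.zero_le _) (Finset.mem_univ a)
    rw [finprod_mult_succ _ h0 g _ hN, finprod_mult_succ _ h0 (shiftOn I g) (∑ a, g a + 1),
      Finset.prod_range_succ', mul_comm]
    · congr 2
      · unfold mult
        congr 1
        ext a
        simp only [Finset.mem_filter, Finset.mem_univ, true_and, Finset.mem_sdiff, mem_posSet]
        unfold shiftOn
        have := hg' a
        split_ifs <;> simp_all
      · funext k
        congr 1
        unfold mult
        congr 1
        ext a
        simp only [Finset.mem_filter, Finset.mem_univ, true_and]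
        unfold shiftOn
        have := hg' a
        split_ifs <;> simp_all
    · intro a
      have := hN a
      unfold shiftOn
      split_ifs <;> omega
  have e2 : ∏ a ∈ I, (1 - s * u a)⁻¹ * jumpRatio s u a ^ (shiftOn I g a - 1) =
      (∏ b ∈ I \ posSet g, (1 - s * u b)⁻¹) * (∏ a ∈ posSet g, jumpRatio s u a) *
        ∏ a ∈ posSet g, (1 - s * u a)⁻¹ * jumpRatio s u a ^ (g a - 1) := by
    rw [← Finset.prod_sdiff hg, mul_assoc, ← Finset.prod_mul_distrib]
    congr 1
    · refine Finset.prod_congr rfl fun a ha => ?_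
      rw [Finset.mem_sdiff, mem_posSet] at ha
      have : g a = 0 := by omega
      simp [shiftOn, this, ha.1]
    · refine Finset.prod_congr rfl fun a ha => ?_
      have haI := hg ha
      rw [mem_posSet] at ha
      obtain ⟨m, hm⟩ := Nat.exists_eq_succ_of_ne_zero ha.ne'
      simp only [shiftOn, haI, if_true, hm, Nat.succ_eq_add_one, Nat.add_sub_cancel]
      ring
  have e3 : (Finset.univ : Finset (Fin n × Fin n)).filter
        (fun p => shiftOn I g p.2 < shiftOn I g p.1 ∧ 0 < shiftOn I g p.2) =
      (posSet g ×ˢ (I \ posSet g)).disjUnion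
        (Finset.univ.filter (fun p => g p.2 < g p.1 ∧ 0 < g p.2)) (by
          rw [Finset.disjoint_left]
          rintro ⟨a, b⟩ h1 h2
          simp only [Finset.mem_product, Finset.mem_sdiff, mem_posSet, Finset.mem_filter] at h1 h2
          exact h1.2.2 h2.2.2) := by
    ext ⟨a, b⟩
    simp only [Finset.mem_filter, Finset.mem_univ, true_and, Finset.mem_disjUnion,
      Finset.mem_product, Finset.mem_sdiff, mem_posSet, shiftOn]
    have ha := hg' a
    have hb := hg' b
    by_cases h1 : a ∈ I <;> by_cases h2 : b ∈ I <;> simp [h1, h2] at ha hb ⊢ <;> omega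
  unfold configWeight
  rw [hpos, e1, e2, e3, Finset.prod_disjUnion, Finset.prod_product]
  unfold columnWeight
  ring

/-- `∏ᵢ q ^ #{a : yᵢ < fₐ}`. -/
def heightProd (q : ℂ) {n l : ℕ} (y : Fin l → ℕ) (f : Fin n → ℕ) : ℂ :=
  ∏ i, q ^ height f (y i + 1)

theorem heightProd_shiftOn (q : ℂ) {n l : ℕ} (y : Fin l → ℕ) (I : Finset (Fin n))
    (g : Fin n → ℕ) (hg : posSet g ⊆ I) :
    heightProd q (fun i => y i + 1) (shiftOn I g) = heightProd q y g := by
  unfold heightProd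
  refine Finset.prod_congr rfl fun i _ => ?_
  congr 1
  unfold height
  congr 1
  ext a
  have := @hg a
  simp only [mem_posSet, Finset.mem_filter, Finset.mem_univ, true_and] at this ⊢
  unfold shiftOn
  split_ifs with h
  · omega
  · simp only [h, imp_false] at this
    omega

theorem heightProd_last_eq_zero (q : ℂ) {n l : ℕ} (y : Fin (l + 1) → ℕ)
    (hy : y (Fin.last l) = 0) (f : Fin n → ℕ) :
    heightProd q y f = q ^ #(posSet f) * heightProd q (Fin.init y) f := by
  unfold heightProd
  rw [Fin.prod_univ_castSucc, mul_comm, hy]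
  rfl

/-- The contribution of the configurations whose particles to the right of the origin are
exactly those in `I`. -/
def configTerm (q s : ℂ) {n l : ℕ} (u : Fin n → ℂ) (y : Fin l → ℕ) (I : Finset (Fin n))
    (f : Fin n → ℕ) : ℂ :=
  if posSet f = I then configWeight q s u f * heightProd q y f else 0

theorem configTerm_hasSum_shift_iff (q s : ℂ) {n l : ℕ} (u : Fin n → ℂ) (y : Fin l → ℕ)
    (I : Finset (Fin n)) (A : ℂ) :
    HasSum (configTerm q s u (fun i => y i + 1) I) A ↔
      HasSum (fun g => ∑ J ∈ I.powerset, columnWeight q s u I J * configTerm q s u y J g) A := by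
  rw [← (shiftOn_injective I).hasSum_iff]
  · refine iff_of_eq (congrArg (fun F => HasSum F A) ?_)
    funext g
    unfold configTerm
    simp only [Function.comp, posSet_shiftOn, mul_ite, mul_zero, Finset.sum_ite_eq,
      Finset.mem_powerset]
    split_ifs with h
    · rw [configWeight_shiftOn q s u I g h, heightProd_shiftOn q y I g h, mul_assoc]
    · rfl
  · intro f hf
    unfold configTerm
    rw [if_neg]
    intro h
    refine hf ⟨fun a => f a - if a ∈ I then 1 else 0, ?_⟩
    funext a
    change (f a - if a ∈ I then 1 else 0) + (if a ∈ I then 1 else 0) = f a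
    split_ifs with ha
    · rw [← h, mem_posSet] at ha
      omega
    · omega

theorem configTerm_hasSum_shift (q s : ℂ) {n l : ℕ} (u : Fin n → ℂ) (y : Fin l → ℕ)
    (I : Finset (Fin n)) (A : Finset (Fin n) → ℂ)
    (hA : ∀ J ⊆ I, HasSum (configTerm q s u y J) (A J)) :
    HasSum (configTerm q s u (fun i => y i + 1) I)
      (∑ J ∈ I.powerset, columnWeight q s u I J * A J) := by
  rw [configTerm_hasSum_shift_iff]
  exact hasSum_sum fun J hJ => (hA J (Finset.mem_powerset.1 hJ)).mul_left _

theorem hasSum_configTerm_zero (q s : ℂ) (hs : s ≠ 0) {n : ℕ} (u : Fin n → ℂ)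
    (hu : Function.Injective u) (hsu : ∀ a, 1 - s * u a ≠ 0)
    (hp : ∀ a, ‖jumpRatio s u a‖ < 1) (y : Fin 0 → ℕ)
    (hsum : ∀ I, Summable (configTerm q s u y I)) (I : Finset (Fin n)) :
    HasSum (configTerm q s u y I) 1 := by
  induction I using Finset.strongInduction with
  | H I ih =>
    obtain ⟨A, hA⟩ := hsum I
    rcases I.eq_empty_or_nonempty with rfl | hne
    · have : ∀ f : Fin n → ℕ, f ≠ 0 → configTerm q s u y ∅ f = 0 := by
        intro f hf
        unfold configTerm
        rw [if_neg]
        intro h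
        refine hf (funext fun a => ?_)
        have : a ∉ posSet f := by simp [h]
        rw [mem_posSet] at this
        exact Nat.eq_zero_of_not_pos this
      have h0 : configTerm q s u y ∅ 0 = 1 := by
        have hm : ∀ k, mult (0 : Fin n → ℕ) (k + 1) = 0 := by
          intro k
          exact mult_eq_zero fun a => by simp
        have hp0 : posSet (0 : Fin n → ℕ) = ∅ := by simp [posSet]
        simp [configTerm, configWeight, heightProd, hm, hp0, qPoch]
      rw [← h0]
      exact hasSum_single 0 this
    · have h1 := configTerm_hasSum_shift q s u y I (fun J => if J = I then A else 1) (by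
        intro J hJ
        split_ifs with h
        · rw [h]; exact hA
        · exact ih J (hJ.ssubset_of_ne h))
      have hy : (fun i => y i + 1) = y := funext fun i => i.elim0
      rw [hy] at h1
      have h2 := hA.unique h1
      have h3 := sum_columnWeight q s hs u hu hsu I
      have h4 : ∑ J ∈ I.powerset, columnWeight q s u I J * (if J = I then A else 1) =
          1 + columnWeight q s u I I * (A - 1) := by
        rw [← sub_eq_iff_eq_add']
        conv_lhs => rw [← h3]
        rw [← Finset.sum_sub_distrib, Finset.sum_eq_single I]
        · simp
          ring
        · intro J _ hJ
          simp [hJ, h3]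
        · simp
      rw [h4] at h2
      have h5 : columnWeight q s u I I = ∏ a ∈ I, jumpRatio s u a := by
        simp [columnWeight, qPoch]
      have h6 : ‖columnWeight q s u I I‖ < 1 := by
        rw [h5, norm_prod]
        obtain ⟨a, ha⟩ := hne
        rw [← Finset.mul_prod_erase _ _ ha]
        exact mul_lt_one_of_nonneg_of_lt_one_left (norm_nonneg _) (hp a)
          (Finset.prod_le_one (fun _ _ => norm_nonneg _) fun a _ => (hp a).le)
      have h7 : 1 - columnWeight q s u I I ≠ 0 := by
        intro h
        rw [← sub_eq_zero.1 h] at h6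
        simp at h6
      have h8 : (1 - columnWeight q s u I I) * (A - 1) = 0 := by linear_combination h2
      rcases mul_eq_zero.1 h8 with h | h
      · exact absurd h h7
      · rwa [← sub_eq_zero.1 h]

theorem hasSum_configTerm (q s : ℂ) (hs : s ≠ 0) {n : ℕ} (u : Fin n → ℂ)
    (hu : Function.Injective u) (hu0 : ∀ a, u a ≠ 0) (hsu : ∀ a, 1 - s * u a ≠ 0)
    (hp : ∀ a, ‖jumpRatio s u a‖ < 1)
    (hsum : ∀ (y : Fin 0 → ℕ) I, Summable (configTerm q s u y I))
    (l : ℕ) (y : Fin l → ℕ) (hy : Antitone y) (I : Finset (Fin n)) :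
    HasSum (configTerm q s u y I) (residueSum q s u l y I) := by
  induction l generalizing I with
  | zero => exact hasSum_configTerm_zero q s hs u hu hsu hp y (hsum y) I
  | succ l ih =>
    generalize hm : y (Fin.last l) = m
    induction m generalizing y I with
    | zero =>
      rw [residueSum_last_eq_zero q s u hu hu0 l y hm]
      have h := (ih (Fin.init y) (fun i j hij => hy (Fin.castSucc_le_castSucc_iff.2 hij))
        I).mul_left (q ^ #I)
      refine (congrArg (fun F => HasSum F _) (funext fun f => ?_)).mpr h
      unfold configTerm
      split_ifs with hf
      · rw [heightProd_last_eq_zero q y hm, hf]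
        ring
      · simp
    | succ m ihm =>
      have hpos : ∀ i, y i = (y i - 1) + 1 := by
        intro i
        have := hy (Fin.le_last i)
        omega
      have hy1 : y = fun i => (fun i => y i - 1) i + 1 := funext hpos
      rw [hy1, residueSum_add_one q s hs u hu hsu]
      refine configTerm_hasSum_shift q s u _ I (residueSum q s u (l + 1) fun i => y i - 1) ?_
      intro J _
      exact ihm _ (fun i j hij => Nat.sub_le_sub_right (hy hij) 1) _ (by simp [hm])

theorem prod_univ_eq_mul_prod_swap_succ {M : Type*} [CommMonoid M] {k : ℕ} (a : Fin (k + 1))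
    (F : Fin (k + 1) → M) :
    ∏ b, F b = F a * ∏ i : Fin k, F (Equiv.swap 0 a i.succ) := by
  rw [← Equiv.prod_comp (Equiv.swap 0 a) F, Fin.prod_univ_succ, Equiv.swap_apply_left]

theorem mult_eq_add_mult_swap_succ {k : ℕ} (a : Fin (k + 1)) (f : Fin (k + 1) → ℕ) (v : ℕ) :
    mult f v = (if f a = v then 1 else 0) + mult (fun i => f (Equiv.swap 0 a i.succ)) v := by
  unfold mult
  rw [Finset.card_filter, Finset.card_filter, ← Equiv.sum_comp (Equiv.swap 0 a),
    Fin.sum_univ_succ, Equiv.swap_apply_left]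

theorem antitone_decomposeFin_symm {k : ℕ} (a : Fin (k + 1)) (τ : Equiv.Perm (Fin k))
    (f : Fin (k + 1) → ℕ) :
    Antitone (f ∘ Equiv.Perm.decomposeFin.symm (a, τ)) ↔
      (∀ c, f c ≤ f a) ∧ Antitone ((fun i => f (Equiv.swap 0 a i.succ)) ∘ τ) := by
  constructor
  · intro h
    constructor
    · intro c
      have := h (Fin.zero_le ((Equiv.Perm.decomposeFin.symm (a, τ)).symm c))
      simpa using this
    · intro i j hij
      have := h (Fin.succ_le_succ_iff.2 hij)
      simpa using this
  · rintro ⟨h1, h2⟩ i j hij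
    induction i using Fin.cases with
    | zero => simpa using h1 _
    | succ i =>
      induction j using Fin.cases with
      | zero => exact absurd hij (by simp)
      | succ j => simpa using h2 (Fin.succ_le_succ_iff.1 hij)

theorem prod_lt_decomposeFin_symm {k : ℕ} (a : Fin (k + 1)) (τ : Equiv.Perm (Fin k))
    (F : Fin (k + 1) → Fin (k + 1) → ℂ) :
    ∏ p ∈ (Finset.univ : Finset (Fin (k + 1) × Fin (k + 1))).filter (fun p => p.1 < p.2),
        F (Equiv.Perm.decomposeFin.symm (a, τ) p.1) (Equiv.Perm.decomposeFin.symm (a, τ) p.2) =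
      (∏ i : Fin k, F a (Equiv.swap 0 a i.succ)) *
        ∏ p ∈ (Finset.univ : Finset (Fin k × Fin k)).filter (fun p => p.1 < p.2),
          F (Equiv.swap 0 a (τ p.1).succ) (Equiv.swap 0 a (τ p.2).succ) := by
  rw [Finset.prod_filter, Finset.prod_filter, Fintype.prod_prod_type, Fintype.prod_prod_type]
  simp only [Fin.prod_univ_succ, Equiv.Perm.decomposeFin_symm_apply_zero,
    Equiv.Perm.decomposeFin_symm_apply_succ, Fin.succ_lt_succ_iff, Fin.succ_pos, if_true,
    if_false, Fin.not_lt_zero, one_mul]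
  rw [Equiv.prod_comp τ fun i => F a (Equiv.swap 0 a i.succ)]

theorem prod_scat_of_forall_le (q : ℂ) {k : ℕ} (u : Fin (k + 1) → ℂ) (f : Fin (k + 1) → ℕ)
    (a : Fin (k + 1)) (ha : ∀ c, f c ≤ f a) :
    (∏ i : Fin k, scat q u a (Equiv.swap 0 a i.succ)) *
        ∏ p ∈ (Finset.univ : Finset (Fin k × Fin k)).filter
          (fun p => f (Equiv.swap 0 a p.2.succ) < f (Equiv.swap 0 a p.1.succ)),
          scat q u (Equiv.swap 0 a p.1.succ) (Equiv.swap 0 a p.2.succ) =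
      (∏ b ∈ (Finset.univ.filter fun b => f b = f a).erase a, scat q u a b) *
        ∏ p ∈ (Finset.univ : Finset (Fin (k + 1) × Fin (k + 1))).filter
          (fun p => f p.2 < f p.1), scat q u p.1 p.2 := by
  have h1 : ∏ b ∈ (Finset.univ.filter fun b => f b = f a).erase a, scat q u a b =
      ∏ i : Fin k, if f (Equiv.swap 0 a i.succ) = f a
        then scat q u a (Equiv.swap 0 a i.succ) else 1 := by
    have : (Finset.univ.filter fun b => f b = f a).erase a =
        Finset.univ.filter fun b => b ≠ a ∧ f b = f a := by
      ext b
      simp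
    rw [this, Finset.prod_filter, prod_univ_eq_mul_prod_swap_succ a]
    have hne : ∀ i : Fin k, Equiv.swap 0 a i.succ ≠ a := by
      intro i h
      have h' : Equiv.swap 0 a i.succ = Equiv.swap 0 a 0 := by rw [h, Equiv.swap_apply_left]
      exact Fin.succ_ne_zero i ((Equiv.swap 0 a).injective h')
    simp [hne]
  rw [h1, Finset.prod_filter, Finset.prod_filter, Fintype.prod_prod_type, Fintype.prod_prod_type,
    prod_univ_eq_mul_prod_swap_succ a]
  have row : ∀ b, ∏ j, (if f j < f b then scat q u b j else 1) =
      (if f a < f b then scat q u b a else 1) *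
        ∏ i : Fin k, if f (Equiv.swap 0 a i.succ) < f b
          then scat q u b (Equiv.swap 0 a i.succ) else 1 :=
    fun b => prod_univ_eq_mul_prod_swap_succ a fun j => if f j < f b then scat q u b j else 1
  simp only [row, lt_irrefl, if_false, one_mul, fun c => not_lt.2 (ha c)]
  rw [← mul_assoc, ← Finset.prod_mul_distrib (f := fun i => if _ = f a then _ else _)]
  congr 1
  refine Finset.prod_congr rfl fun i _ => ?_
  have := ha (Equiv.swap 0 a i.succ)
  rcases this.lt_or_eq with h | h
  · simp [h, h.ne]
  · simp [h]

theorem sum_antitone_prod_scat (q : ℂ) {k : ℕ} (u : Fin k → ℂ) (hu : Function.Injective u)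
    (hu0 : ∀ a, u a ≠ 0) (f : Fin k → ℕ) (N : ℕ) (hN : ∀ a, f a < N) :
    (1 - q) ^ k * ∑ σ : Equiv.Perm (Fin k), (if Antitone (f ∘ σ) then
      ∏ p ∈ (Finset.univ : Finset (Fin k × Fin k)).filter (fun p => p.1 < p.2),
        scat q u (σ p.1) (σ p.2) else 0) =
      (∏ p ∈ (Finset.univ : Finset (Fin k × Fin k)).filter (fun p => f p.2 < f p.1),
        scat q u p.1 p.2) * ∏ v ∈ Finset.range N, qPoch q q (mult f v) := by
  induction k with
  | zero =>
    have : ∀ σ : Equiv.Perm (Fin 0), Antitone (f ∘ σ) := fun σ i => i.elim0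
    simp [this, mult, qPoch]
  | succ k ih =>
    obtain ⟨a₀, ha₀⟩ := Finite.exists_max f
    set A := Finset.univ.filter fun b => f b = f a₀ with hA
    have hmax : ∀ a, (∀ c, f c ≤ f a) ↔ a ∈ A := by
      intro a
      simp only [hA, Finset.mem_filter, Finset.mem_univ, true_and]
      exact ⟨fun h => (ha₀ a).antisymm (h a₀), fun h c => h ▸ ha₀ c⟩
    rw [← Equiv.sum_comp Equiv.Perm.decomposeFin.symm, Fintype.sum_prod_type]
    simp only [antitone_decomposeFin_symm, hmax,
      prod_lt_decomposeFin_symm _ _ (fun b c => scat q u b c), ite_and]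
    have hin : ∀ a ∈ A, (1 - q) ^ k * ∑ τ : Equiv.Perm (Fin k),
        (if Antitone ((fun i => f (Equiv.swap 0 a i.succ)) ∘ τ) then
          ∏ p ∈ (Finset.univ : Finset (Fin k × Fin k)).filter (fun p => p.1 < p.2),
            scat q u (Equiv.swap 0 a (τ p.1).succ) (Equiv.swap 0 a (τ p.2).succ) else 0) =
        (∏ p ∈ (Finset.univ : Finset (Fin k × Fin k)).filter
          (fun p => f (Equiv.swap 0 a p.2.succ) < f (Equiv.swap 0 a p.1.succ)),
          scat q u (Equiv.swap 0 a p.1.succ) (Equiv.swap 0 a p.2.succ)) *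
          ∏ v ∈ Finset.range N, qPoch q q (mult (fun i => f (Equiv.swap 0 a i.succ)) v) := by
      intro a _
      exact ih (fun i => u (Equiv.swap 0 a i.succ))
        (fun i j h => Fin.succ_injective k ((Equiv.swap 0 a).injective (hu h)))
        (fun i => hu0 _) _ (fun i => hN _)
    have hterm : ∀ a, (1 - q) ^ k * ∑ τ : Equiv.Perm (Fin k), (if a ∈ A then
        if Antitone ((fun i => f (Equiv.swap 0 a i.succ)) ∘ τ) then
          (∏ i : Fin k, scat q u a (Equiv.swap 0 a i.succ)) *
          ∏ p ∈ (Finset.univ : Finset (Fin k × Fin k)).filter (fun p => p.1 < p.2),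
            scat q u (Equiv.swap 0 a (τ p.1).succ) (Equiv.swap 0 a (τ p.2).succ) else 0
        else 0) =
        if a ∈ A then (∏ b ∈ A.erase a, scat q u a b) *
          ((∏ p ∈ (Finset.univ : Finset (Fin (k + 1) × Fin (k + 1))).filter
            (fun p => f p.2 < f p.1), scat q u p.1 p.2) *
            ((∏ v ∈ (Finset.range N).erase (f a₀), qPoch q q (mult f v)) *
              qPoch q q (#A - 1))) else 0 := by
      intro a
      split_ifs with ha
      · have hfa : f a = f a₀ := by simpa [hA] using ha
        have hmul : ∀ τ : Equiv.Perm (Fin k),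
            (if Antitone ((fun i => f (Equiv.swap 0 a i.succ)) ∘ τ) then
              (∏ i : Fin k, scat q u a (Equiv.swap 0 a i.succ)) *
              ∏ p ∈ (Finset.univ : Finset (Fin k × Fin k)).filter (fun p => p.1 < p.2),
                scat q u (Equiv.swap 0 a (τ p.1).succ) (Equiv.swap 0 a (τ p.2).succ) else 0) =
            (∏ i : Fin k, scat q u a (Equiv.swap 0 a i.succ)) *
            (if Antitone ((fun i => f (Equiv.swap 0 a i.succ)) ∘ τ) then
              ∏ p ∈ (Finset.univ : Finset (Fin k × Fin k)).filter (fun p => p.1 < p.2),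
                scat q u (Equiv.swap 0 a (τ p.1).succ) (Equiv.swap 0 a (τ p.2).succ) else 0) := by
          intro τ
          rw [mul_ite, mul_zero]
        rw [Finset.sum_congr rfl fun τ _ => hmul τ, ← Finset.mul_sum, mul_left_comm, hin a ha,
          ← mul_assoc, prod_scat_of_forall_le q u f a ((hmax a).2 ha), hfa, ← hA, mul_assoc]
        congr 2
        rw [← Finset.prod_erase_mul _ _ (Finset.mem_range.2 (hN a₀))]
        congr 1
        · refine Finset.prod_congr rfl fun v hv => ?_
          rw [mult_eq_add_mult_swap_succ a f v, if_neg, zero_add]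
          rw [hfa]
          exact (Finset.ne_of_mem_erase hv).symm
        · congr 1
          have h1 := mult_eq_add_mult_swap_succ a f (f a₀)
          rw [if_pos hfa] at h1
          have h2 : mult f (f a₀) = #A := rfl
          omega
      · simp
    rw [pow_succ', mul_assoc, Finset.mul_sum, Finset.sum_congr rfl fun a _ => hterm a,
      Finset.sum_ite_mem, Finset.univ_inter, ← Finset.sum_mul, ← mul_assoc,
      one_sub_mul_sum_prod_scat q u hu hu0 A, ← Finset.prod_erase_mul _ _
        (Finset.mem_range.2 (hN a₀))]
    have h2 : mult f (f a₀) = #A := rfl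
    have h3 : 0 < #A := Finset.card_pos.2 ⟨a₀, by simp [hA]⟩
    obtain ⟨m, hm⟩ := Nat.exists_eq_succ_of_ne_zero h3.ne'
    rw [h2, hm]
    have h4 : qPoch q q (m + 1) = qPoch q q m * (1 - q ^ (m + 1)) := by
      unfold qPoch
      rw [Finset.prod_range_succ, pow_succ']
    rw [Nat.succ_eq_add_one, h4, Nat.add_sub_cancel]
    ring

theorem summable_prod_pow {n : ℕ} (p : Fin n → ℝ) (h0 : ∀ a, 0 ≤ p a) (h1 : ∀ a, p a < 1) :
    Summable fun f : Fin n → ℕ => ∏ a, p a ^ f a := by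
  induction n with
  | zero => exact Summable.of_finite
  | succ n ih =>
    rw [← (Fin.consEquiv fun _ : Fin (n + 1) => ℕ).summable_iff]
    have h := (summable_geometric_of_lt_one (h0 0) (h1 0)).mul_of_nonneg
      (ih (fun a => p a.succ) (fun a => h0 _) fun a => h1 _)
      (fun m => pow_nonneg (h0 0) m) fun f => Finset.prod_nonneg fun a _ => pow_nonneg (h0 _) _
    refine h.congr fun x => ?_
    simp [Fin.consEquiv, Fin.prod_univ_succ]

theorem exists_norm_prod_mult_le (h : ℕ → ℂ) (h0 : h 0 = 1) (n : ℕ) :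
    ∃ C : ℝ, 0 ≤ C ∧ ∀ (f : Fin n → ℕ) (S : Finset ℕ), ‖∏ k ∈ S, h (mult f k)‖ ≤ C := by
  set K : ℝ := 1 + ∑ m ∈ Finset.range (n + 1), ‖h m‖ with hK
  have hK1 : 1 ≤ K := le_add_of_nonneg_right (Finset.sum_nonneg fun _ _ => norm_nonneg _)
  refine ⟨K ^ n, by positivity, fun f S => ?_⟩
  have hm : ∀ k, mult f k ≤ n := fun k => by
    unfold mult
    simpa using Finset.card_le_univ (Finset.univ.filter fun i => f i = k)
  have hh : ∀ m ≤ n, ‖h m‖ ≤ K ^ m := by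
    intro m hmn
    rcases Nat.eq_zero_or_pos m with rfl | hpos
    · simp [h0]
    · calc ‖h m‖ ≤ ∑ m ∈ Finset.range (n + 1), ‖h m‖ :=
            Finset.single_le_sum (f := fun m => ‖h m‖) (fun _ _ => norm_nonneg _)
              (Finset.mem_range.2 (Nat.lt_succ_of_le hmn))
        _ ≤ K := by rw [hK]; linarith
        _ ≤ K ^ m := le_self_pow₀ hK1 hpos.ne'
  rw [norm_prod]
  calc ∏ k ∈ S, ‖h (mult f k)‖ ≤ ∏ k ∈ S, K ^ mult f k :=
        Finset.prod_le_prod (fun _ _ => norm_nonneg _) fun k _ => hh _ (hm k)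
    _ = K ^ ∑ k ∈ S, mult f k := Finset.prod_pow_eq_pow_sum _ _ _
    _ ≤ K ^ n := by
        refine pow_le_pow_right₀ hK1 ?_
        unfold mult
        rw [Finset.sum_card_fiberwise_eq_card_filter]
        simpa using Finset.card_le_univ (Finset.univ.filter fun i => f i ∈ S)

theorem exists_norm_prod_posSet_le {n : ℕ} (c P : Fin n → ℂ) (hP : ∀ a, P a ≠ 0) :
    ∃ C : ℝ, 0 ≤ C ∧ ∀ f : Fin n → ℕ,
      ‖∏ a ∈ posSet f, c a * P a ^ (f a - 1)‖ ≤ C * ∏ a, ‖P a‖ ^ f a := by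
  refine ⟨∏ a, (1 + ‖c a‖ / ‖P a‖), Finset.prod_nonneg fun a _ => by positivity, fun f => ?_⟩
  unfold posSet
  rw [norm_prod, Finset.prod_filter, ← Finset.prod_mul_distrib]
  refine Finset.prod_le_prod (fun a _ => by split_ifs <;> positivity) fun a _ => ?_
  have hPa : 0 < ‖P a‖ := norm_pos_iff.2 (hP a)
  split_ifs with h
  · obtain ⟨m, hm⟩ := Nat.exists_eq_succ_of_ne_zero h.ne'
    rw [hm, Nat.succ_eq_add_one, Nat.add_sub_cancel, norm_mul, norm_pow, add_mul, one_mul]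
    have : ‖c a‖ / ‖P a‖ * ‖P a‖ ^ (m + 1) = ‖c a‖ * ‖P a‖ ^ m := by
      field_simp
      ring
    rw [this]
    exact le_add_of_nonneg_left (by positivity)
  · rw [Nat.eq_zero_of_not_pos h, pow_zero, mul_one]
    exact le_add_of_nonneg_right (by positivity)

theorem norm_heightProd_le (q : ℂ) (hq : ‖q‖ ≤ 1) {n l : ℕ} (y : Fin l → ℕ) (f : Fin n → ℕ) :
    ‖heightProd q y f‖ ≤ 1 := by
  unfold heightProd
  rw [norm_prod]
  exact Finset.prod_le_one (fun _ _ => norm_nonneg _) fun i _ => by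
    rw [norm_pow]
    exact pow_le_one₀ (norm_nonneg _) hq

theorem mult_sub_one {n : ℕ} (f : Fin n → ℕ) (hf : ∀ i, 1 ≤ f i) (k : ℕ) :
    mult (fun i => f i - 1) k = mult f (k + 1) := by
  unfold mult
  congr 1
  ext i
  have := hf i
  simp only [Finset.mem_filter, Finset.mem_univ, true_and]
  omega

theorem posSet_eq_univ {n : ℕ} {f : Fin n → ℕ} : posSet f = Finset.univ ↔ ∀ i, 1 ≤ f i := by
  simp [Finset.ext_iff, mem_posSet, Nat.one_le_iff_ne_zero, Nat.pos_iff_ne_zero]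

/-- The part of the weight of a signature that depends on the labelling only through
the position of each label. -/
def labelledTerm (q s : ℂ) {n l : ℕ} (u : Fin n → ℂ) (y : Fin l → ℕ) (f : Fin n → ℕ) : ℂ :=
  (if ∀ i, 1 ≤ f i then (1 : ℂ) else 0) * cconst q s (fun i => f i - 1) *
    (∏ a, jumpRatio s u a ^ (f a - 1)) * heightProd q y f

theorem cconst_eq_prod (q s : ℂ) {n : ℕ} (f : Fin n → ℕ) (hf : ∀ i, 1 ≤ f i) :
    cconst q s (fun i => f i - 1) = ∏ k ∈ Finset.range (∑ a, f a),
      qPoch (s ^ 2) q (mult f (k + 1)) / qPoch q q (mult f (k + 1)) := by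
  unfold cconst
  simp only [mult_sub_one f hf]
  exact finprod_mult_succ (fun m => qPoch (s ^ 2) q m / qPoch q q m) (by simp [qPoch]) f _
    fun a => Finset.single_le_sum (f := f) (fun _ _ => Nat.zero_le _) (Finset.mem_univ a)

theorem summable_labelledTerm (q s : ℂ) (hq : ‖q‖ ≤ 1) {n l : ℕ} (u : Fin n → ℂ)
    (y : Fin l → ℕ) (hP : ∀ a, jumpRatio s u a ≠ 0) (hp : ∀ a, ‖jumpRatio s u a‖ < 1) :
    Summable (labelledTerm q s u y) := by
  obtain ⟨C₁, hC₁, h1⟩ := exists_norm_prod_mult_le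
    (fun m => qPoch (s ^ 2) q m / qPoch q q m) (by simp [qPoch]) n
  obtain ⟨C₂, hC₂, h2⟩ := exists_norm_prod_posSet_le (fun _ => 1) (jumpRatio s u) hP
  refine Summable.of_norm_bounded
    ((summable_prod_pow (fun a => ‖jumpRatio s u a‖) (fun _ => norm_nonneg _) hp).mul_left
      (C₁ * C₂)) fun f => ?_
  unfold labelledTerm
  split_ifs with hf
  · have e := h2 f
    rw [posSet_eq_univ.2 hf] at e
    simp only [one_mul] at e
    have e1 := h1 f ((Finset.range (∑ a, f a)).map ⟨Nat.succ, Nat.succ_injective⟩)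
    rw [Finset.prod_map] at e1
    rw [cconst_eq_prod q s f hf, one_mul, norm_mul, norm_mul, mul_assoc C₁]
    calc _ ≤ (C₁ * (C₂ * ∏ a, ‖jumpRatio s u a‖ ^ f a)) * 1 := by
          gcongr
          · exact e1
          · exact norm_heightProd_le q hq y f
      _ = _ := mul_one _
  · simp only [zero_mul, norm_zero]
    positivity

theorem summable_configTerm (q s : ℂ) (hq : ‖q‖ ≤ 1) {n l : ℕ} (u : Fin n → ℂ)
    (y : Fin l → ℕ) (hP : ∀ a, jumpRatio s u a ≠ 0) (hp : ∀ a, ‖jumpRatio s u a‖ < 1)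
    (I : Finset (Fin n)) : Summable (configTerm q s u y I) := by
  obtain ⟨C₁, hC₁, h1⟩ := exists_norm_prod_mult_le (fun m => qPoch (s ^ 2) q m) (by simp [qPoch]) n
  obtain ⟨C₂, hC₂, h2⟩ := exists_norm_prod_posSet_le (fun a => (1 - s * u a)⁻¹) (jumpRatio s u) hP
  obtain ⟨C₃, hC₃, h3⟩ : ∃ C : ℝ, 0 ≤ C ∧ ∀ S : Finset (Fin n × Fin n),
      ‖∏ p ∈ S, scat q u p.1 p.2‖ ≤ C :=
    ⟨∑ S : Finset (Fin n × Fin n), ‖∏ p ∈ S, scat q u p.1 p.2‖,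
      Finset.sum_nonneg fun _ _ => norm_nonneg _, fun S =>
      Finset.single_le_sum (f := fun S : Finset (Fin n × Fin n) => ‖∏ p ∈ S, scat q u p.1 p.2‖)
        (fun _ _ => norm_nonneg _) (Finset.mem_univ S)⟩
  refine Summable.of_norm_bounded
    ((summable_prod_pow (fun a => ‖jumpRatio s u a‖) (fun _ => norm_nonneg _) hp).mul_left
      (C₁ * C₂ * C₃)) fun f => ?_
  unfold configTerm
  split_ifs with hf
  · have e1 := h1 f ((Finset.range (∑ a, f a)).map ⟨Nat.succ, Nat.succ_injective⟩)
    rw [Finset.prod_map] at e1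
    unfold configWeight
    rw [finprod_mult_succ (fun m => qPoch (s ^ 2) q m) (by simp [qPoch]) f (∑ a, f a) fun a =>
      Finset.single_le_sum (f := f) (fun _ _ => Nat.zero_le _) (Finset.mem_univ a),
      norm_mul, norm_mul, norm_mul]
    calc _ ≤ C₁ * (C₂ * ∏ a, ‖jumpRatio s u a‖ ^ f a) * C₃ * 1 := by
          gcongr
          · exact e1
          · exact h2 f
          · exact h3 _
          · exact norm_heightProd_le q hq y f
      _ = _ := by ring
  · simp only [norm_zero]
    positivity

theorem qPoch_self_ne_zero (q : ℂ) (hq : ‖q‖ < 1) (m : ℕ) : qPoch q q m ≠ 0 := by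
  unfold qPoch
  refine Finset.prod_ne_zero_iff.2 fun i _ h => ?_
  have h1 : ‖q * q ^ i‖ = 1 := by
    rw [← sub_eq_zero.1 h, norm_one]
  rw [← pow_succ', norm_pow] at h1
  exact (pow_lt_one₀ (norm_nonneg _) hq (Nat.succ_ne_zero i)).ne h1

theorem configTerm_univ_eq_sum (q s : ℂ) (hq : ‖q‖ < 1) {n l : ℕ} (u : Fin n → ℂ)
    (hu : Function.Injective u) (hu0 : ∀ a, u a ≠ 0) (y : Fin l → ℕ) (f : Fin n → ℕ) :
    configTerm q s u y Finset.univ f = ∑ σ : Equiv.Perm (Fin n), if Antitone (f ∘ σ) then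
      (1 - q) ^ n / (∏ i, (1 - s * u i)) *
        (∏ p ∈ (Finset.univ : Finset (Fin n × Fin n)).filter (fun p => p.1 < p.2),
          scat q u (σ p.1) (σ p.2)) * labelledTerm q s u y f else 0 := by
  have hN : ∀ a, f a ≤ ∑ a, f a := fun a =>
    Finset.single_le_sum (f := f) (fun _ _ => Nat.zero_le _) (Finset.mem_univ a)
  unfold configTerm labelledTerm
  by_cases hf : ∀ i, 1 ≤ f i
  · rw [if_pos (posSet_eq_univ.2 hf)]
    simp only [if_pos hf]
    have key := sum_antitone_prod_scat q u hu hu0 f (∑ a, f a + 1) fun a =>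
      Nat.lt_succ_of_le (hN a)
    have hm0 : mult f 0 = 0 := mult_eq_zero fun a h => by
      have := hf a
      omega
    have hq0 : qPoch q q 0 = 1 := by simp [qPoch]
    rw [Finset.prod_range_succ', hm0, hq0, mul_one] at key
    have hfilter : (Finset.univ : Finset (Fin n × Fin n)).filter
        (fun p => f p.2 < f p.1 ∧ 0 < f p.2) =
        (Finset.univ : Finset (Fin n × Fin n)).filter (fun p => f p.2 < f p.1) := by
      ext p
      have := hf p.2
      simp only [Finset.mem_filter, Finset.mem_univ, true_and]
      omega
    unfold configWeight
    rw [hfilter, posSet_eq_univ.2 hf, finprod_mult_succ (fun m => qPoch (s ^ 2) q m)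
      (by simp [qPoch]) f _ hN, cconst_eq_prod q s f hf]
    set c := (1 * ∏ k ∈ Finset.range (∑ a, f a),
      qPoch (s ^ 2) q (mult f (k + 1)) / qPoch q q (mult f (k + 1))) *
        (∏ a, jumpRatio s u a ^ (f a - 1)) * heightProd q y f with hc
    have hsum : ∑ σ : Equiv.Perm (Fin n), (if Antitone (f ∘ σ) then
        (1 - q) ^ n / (∏ i, (1 - s * u i)) *
        (∏ p ∈ (Finset.univ : Finset (Fin n × Fin n)).filter (fun p => p.1 < p.2),
          scat q u (σ p.1) (σ p.2)) * c else 0) =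
        c / (∏ i, (1 - s * u i)) * ((1 - q) ^ n * ∑ σ : Equiv.Perm (Fin n),
          (if Antitone (f ∘ σ) then
          ∏ p ∈ (Finset.univ : Finset (Fin n × Fin n)).filter (fun p => p.1 < p.2),
          scat q u (σ p.1) (σ p.2) else 0)) := by
      rw [Finset.mul_sum, Finset.mul_sum]
      refine Finset.sum_congr rfl fun σ _ => ?_
      split_ifs <;> ring
    rw [hsum, key, hc, Finset.prod_div_distrib, Finset.prod_mul_distrib, Finset.prod_inv_distrib]
    have hQ : ∏ k ∈ Finset.range (∑ a, f a), qPoch q q (mult f (k + 1)) ≠ 0 :=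
      Finset.prod_ne_zero_iff.2 fun k _ => qPoch_self_ne_zero q hq _
    set Q := ∏ k ∈ Finset.range (∑ a, f a), qPoch q q (mult f (k + 1))
    set R := ∏ k ∈ Finset.range (∑ a, f a), qPoch (s ^ 2) q (mult f (k + 1))
    rw [div_eq_mul_inv, div_eq_mul_inv]
    have hQ' : Q⁻¹ * Q = 1 := inv_mul_cancel₀ hQ
    linear_combination (-(R * (∏ i, (1 - s * u i))⁻¹ * (∏ a, jumpRatio s u a ^ (f a - 1)) *
      (∏ p ∈ (Finset.univ : Finset (Fin n × Fin n)).filter (fun p => f p.2 < f p.1),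
        scat q u p.1 p.2) * heightProd q y f)) * hQ'
  · rw [if_neg fun h => hf (posSet_eq_univ.1 h)]
    simp [hf]

theorem mult_comp_perm {n : ℕ} (f : Fin n → ℕ) (σ : Equiv.Perm (Fin n)) (k : ℕ) :
    mult (fun i => f (σ i)) k = mult f k := by
  unfold mult
  rw [Finset.card_filter, Finset.card_filter]
  exact Equiv.sum_comp σ fun i => if f i = k then 1 else 0

theorem height_comp_perm {n : ℕ} (f : Fin n → ℕ) (σ : Equiv.Perm (Fin n)) (k : ℕ) :
    height (fun i => f (σ i)) k = height f k := by
  unfold height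
  rw [Finset.card_filter, Finset.card_filter]
  exact Equiv.sum_comp σ fun i => if k ≤ f i then 1 else 0

theorem Mwt_mul_heightProd (q s : ℂ) {n l : ℕ} (u : Fin n → ℂ) (y : Fin l → ℕ)
    (ν : Fin n → ℕ) :
    Mwt q s u ν * heightProd q y ν = ∑ σ : Equiv.Perm (Fin n),
      (1 - q) ^ n / (∏ i, (1 - s * u i)) *
        (∏ p ∈ (Finset.univ : Finset (Fin n × Fin n)).filter (fun p => p.1 < p.2),
          scat q u (σ p.1) (σ p.2)) * labelledTerm q s u y (ν ∘ σ.symm) := by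
  unfold Mwt labelledTerm Fc Ffun
  by_cases hν : ∀ i, 1 ≤ ν i
  · have hexp : ∑ i, ν i - n = ∑ i, (ν i - 1) := by
      have : ∑ i, ν i = ∑ i, (ν i - 1) + n := by
        calc ∑ i, ν i = ∑ i, (ν i - 1 + 1) :=
              Finset.sum_congr rfl fun i _ => (Nat.sub_add_cancel (hν i)).symm
          _ = _ := by simp [Finset.sum_add_distrib]
      omega
    rw [if_pos hν, hexp, ← Finset.prod_pow_eq_pow_sum, Finset.mul_sum, Finset.mul_sum,
      Finset.mul_sum, Finset.sum_mul]
    refine Finset.sum_congr rfl fun σ _ => ?_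
    have h1 : ∀ i, 1 ≤ (ν ∘ σ.symm) i := fun i => hν _
    have h2 : cconst q s (fun i => (ν ∘ σ.symm) i - 1) = cconst q s (fun i => ν i - 1) := by
      unfold cconst
      exact finprod_congr fun k => by
        rw [← mult_comp_perm (fun i => ν i - 1) σ.symm k]
        rfl
    have h3 : heightProd q y (ν ∘ σ.symm) = heightProd q y ν := by
      unfold heightProd
      exact Finset.prod_congr rfl fun i _ => by
        rw [← height_comp_perm ν σ.symm]
        rfl
    have h4 : ∏ a, jumpRatio s u a ^ ((ν ∘ σ.symm) a - 1) =
        (∏ i, (-s) ^ (ν i - 1)) *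
          ∏ i, ((u (σ i) - s) / (1 - s * u (σ i))) ^ (ν i - 1) := by
      rw [← Equiv.prod_comp σ, ← Finset.prod_mul_distrib]
      refine Finset.prod_congr rfl fun i _ => ?_
      rw [Function.comp_apply, Equiv.symm_apply_apply, ← mul_pow]
      congr 1
      unfold jumpRatio
      ring
    rw [if_pos h1, h2, h3, h4]
    unfold scat
    ring
  · have : ∀ σ : Equiv.Perm (Fin n), ¬ ∀ i, 1 ≤ (ν ∘ σ.symm) i := fun σ h =>
      hν fun i => by simpa using h (σ i)
    simp only [if_neg hν, if_neg (this _), zero_mul, mul_zero, Finset.sum_const_zero]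

theorem hasSum_Mwt_mul_heightProd (q s : ℂ) (hq : ‖q‖ < 1) (hs : s ≠ 0) {n : ℕ}
    (u : Fin n → ℂ) (hu : Function.Injective u) (hu0 : ∀ a, u a ≠ 0)
    (hsu : ∀ a, 1 - s * u a ≠ 0) (hP : ∀ a, jumpRatio s u a ≠ 0)
    (hp : ∀ a, ‖jumpRatio s u a‖ < 1) {l : ℕ} (y : Fin l → ℕ) (hy : Antitone y) :
    HasSum (fun ν : Sign n => Mwt q s u ν.1 * heightProd q y ν.1)
      (residueSum q s u l y Finset.univ) := by
  have h1 := hasSum_configTerm q s hs u hu hu0 hsu hp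
    (fun y I => summable_configTerm q s hq.le u y hP hp I) l y hy Finset.univ
  set c : Equiv.Perm (Fin n) → ℂ := fun σ => (1 - q) ^ n / (∏ i, (1 - s * u i)) *
    ∏ p ∈ (Finset.univ : Finset (Fin n × Fin n)).filter (fun p => p.1 < p.2),
      scat q u (σ p.1) (σ p.2)
  set φ : Equiv.Perm (Fin n) → (Fin n → ℕ) → ℂ := fun σ f =>
    if Antitone (f ∘ σ) then c σ * labelledTerm q s u y f else 0 with hφ
  have h2 : ∀ σ, Summable (φ σ) := by
    intro σ
    refine Summable.of_norm_bounded
      ((summable_labelledTerm q s hq.le u y hP hp).norm.mul_left ‖c σ‖) fun f => ?_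
    simp only [hφ]
    split_ifs
    · exact (norm_mul _ _).le
    · rw [norm_zero]
      positivity
  have h3 : ∀ σ, HasSum (fun ν : Sign n => c σ * labelledTerm q s u y (ν.1 ∘ σ.symm))
      (∑' f, φ σ f) := by
    intro σ
    have hinj : Function.Injective fun ν : Sign n => (ν.1 ∘ σ.symm : Fin n → ℕ) := by
      intro ν ν' h
      refine Subtype.ext (funext fun i => ?_)
      simpa using congrFun h (σ i)
    have h4 := (hinj.hasSum_iff (f := φ σ) (a := ∑' f, φ σ f) ?_).2 (h2 σ).hasSum
    · convert h4 using 2 with ν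
      have : Antitone ((ν.1 ∘ σ.symm) ∘ σ) := by
        intro i j hij
        simpa using ν.2 i j hij
      simp only [hφ, Function.comp_apply]
      rw [if_pos this]
    · intro f hf
      refine if_neg fun h => hf ⟨⟨f ∘ σ, fun i j hij => h hij⟩, ?_⟩
      funext i
      simp
  have h5 : residueSum q s u l y Finset.univ = ∑ σ, ∑' f, φ σ f := by
    refine h1.unique ?_
    rw [funext (configTerm_univ_eq_sum q s hq u hu hu0 y)]
    exact hasSum_sum fun σ _ => (h2 σ).hasSum
  rw [h5, funext fun ν : Sign n => Mwt_mul_heightProd q s u y ν.1]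
  exact hasSum_sum fun σ _ => h3 σ

theorem continuous_circleIntegral {X : Type*} [TopologicalSpace X] (F : X → ℂ → ℂ) (c : ℂ) (R : ℝ)
    (hF : Continuous fun p : X × ℝ => F p.1 (circleMap c R p.2)) :
    Continuous fun x => ∮ z in C(c, R), F x z := by
  unfold circleIntegral
  refine intervalIntegral.continuous_parametric_intervalIntegral_of_continuous' ?_ _ _
  simp only [deriv_circleMap, smul_eq_mul]
  exact ((continuous_circleMap 0 R).comp continuous_snd |>.mul continuous_const).mul hF

theorem circleIntegral_circleIntegral_swap (F : ℂ → ℂ → ℂ) (c c' : ℂ) (R R' : ℝ)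
    (hF : Continuous fun p : ℝ × ℝ => F (circleMap c R p.1) (circleMap c' R' p.2)) :
    ∮ z in C(c, R), ∮ w in C(c', R'), F z w = ∮ w in C(c', R'), ∮ z in C(c, R), F z w := by
  have h2 : (0 : ℝ) ≤ 2 * Real.pi := Real.two_pi_pos.le
  unfold circleIntegral
  simp only [← intervalIntegral.integral_smul]
  simp only [intervalIntegral.integral_of_le h2, deriv_circleMap]
  rw [MeasureTheory.integral_integral_swap]
  · refine MeasureTheory.integral_congr_ae (Filter.Eventually.of_forall fun y => ?_)
    refine MeasureTheory.integral_congr_ae (Filter.Eventually.of_forall fun x => ?_)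
    exact smul_comm _ _ _
  · rw [MeasureTheory.Measure.prod_restrict]
    have hc : Continuous (Function.uncurry fun x y : ℝ =>
        (circleMap 0 R x * Complex.I) • (circleMap 0 R' y * Complex.I) •
          F (circleMap c R x) (circleMap c' R' y)) := by
      simp only [smul_eq_mul]
      exact ((continuous_circleMap 0 R).comp continuous_fst |>.mul continuous_const).mul
        (((continuous_circleMap 0 R').comp continuous_snd |>.mul continuous_const).mul hF)
    exact (hc.continuousOn.integrableOn_compact
      (isCompact_Icc.prod isCompact_Icc)).mono_set
      (Set.prod_mono Set.Ioc_subset_Icc_self Set.Ioc_subset_Icc_self)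

/-- The sum of the integrals over finitely many circles. -/
def multiCircle {ι : Type*} [Fintype ι] (c : ι → ℂ) (R : ι → ℝ) (g : ℂ → ℂ) : ℂ :=
  ∑ j, ∮ z in C(c j, R j), g z

/-- The union of finitely many circles. -/
def circles {ι : Type*} (c : ι → ℂ) (R : ι → ℝ) : Set ℂ := ⋃ j, Metric.sphere (c j) (R j)

theorem continuous_cons (k : ℕ) :
    Continuous fun p : ℂ × (Fin k → ℂ) => (Fin.cons p.1 p.2 : Fin (k + 1) → ℂ) :=
  continuous_pi fun i => by
    induction i using Fin.cases with
    | zero => simpa using continuous_fst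
    | succ i => exact (continuous_apply i).comp continuous_snd

theorem circleMap_mem_circles {ι : Type*} (c : ι → ℂ) (R : ι → ℝ) (hR : ∀ j, 0 ≤ R j) (j : ι)
    (θ : ℝ) :
    circleMap (c j) (R j) θ ∈ circles c R :=
  Set.mem_iUnion.2 ⟨j, circleMap_mem_sphere _ (hR j) θ⟩

theorem multiCircle_congr {ι : Type*} [Fintype ι] (c : ι → ℂ) (R : ι → ℝ) (hR : ∀ j, 0 ≤ R j)
    {f g : ℂ → ℂ}
    (h : Set.EqOn f g (circles c R)) : multiCircle c R f = multiCircle c R g :=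
  Finset.sum_congr rfl fun j _ => circleIntegral.integral_congr (hR j) fun _ hz =>
    h (Set.mem_iUnion.2 ⟨j, hz⟩)

theorem multiCircle_const_mul {ι : Type*} [Fintype ι] (c : ι → ℂ) (R : ι → ℝ) (a : ℂ) (f : ℂ → ℂ) :
    multiCircle c R (fun z => a * f z) = a * multiCircle c R f := by
  unfold multiCircle
  rw [Finset.mul_sum]
  exact Finset.sum_congr rfl fun j _ => circleIntegral.integral_const_mul _ _ _ _

theorem multiCircle_add {ι : Type*} [Fintype ι] (c : ι → ℂ) (R : ι → ℝ) (hR : ∀ j, 0 ≤ R j)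
    {f g : ℂ → ℂ}
    (hf : ContinuousOn f (circles c R)) (hg : ContinuousOn g (circles c R)) :
    multiCircle c R (fun z => f z + g z) = multiCircle c R f + multiCircle c R g := by
  unfold multiCircle
  rw [← Finset.sum_add_distrib]
  have hsub : ∀ j, Metric.sphere (c j) (R j) ⊆ circles c R := fun j =>
    Set.subset_iUnion (fun j => Metric.sphere (c j) (R j)) j
  exact Finset.sum_congr rfl fun j _ => circleIntegral.integral_add
    ((hf.mono (hsub j)).circleIntegrable (hR j)) ((hg.mono (hsub j)).circleIntegrable (hR j))

/-- The product of the contours of integration. -/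
def contourBox {ι : Type*} {k : ℕ} (c : ι → ℂ) (R : Fin k → ι → ℝ) : Set (Fin k → ℂ) :=
  {w | ∀ i, w i ∈ circles c (R i)}

theorem cons_mem_contourBox {ι : Type*} {k : ℕ} {c : ι → ℂ} {R : Fin (k + 1) → ι → ℝ} {z : ℂ}
    {w : Fin k → ℂ} (hz : z ∈ circles c (R 0)) (hw : w ∈ contourBox c fun i => R i.succ) :
    Fin.cons z w ∈ contourBox c R := by
  intro i
  induction i using Fin.cases with
  | zero => simpa using hz
  | succ i => simpa using hw i

theorem iterInt_congr {ι : Type*} [Fintype ι] {k : ℕ} (c : ι → ℂ) (R : Fin k → ι → ℝ)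
    (hR : ∀ i j, 0 ≤ R i j)
    {f g : (Fin k → ℂ) → ℂ} (h : Set.EqOn f g (contourBox c R)) :
    iterInt k (fun i => multiCircle c (R i)) f = iterInt k (fun i => multiCircle c (R i)) g := by
  induction k with
  | zero => exact h fun i => i.elim0
  | succ k ih =>
    exact multiCircle_congr c _ (hR 0) fun z hz =>
      ih (fun i => R i.succ) (fun i => hR _) fun w hw => h (cons_mem_contourBox hz hw)

theorem iterInt_const_mul {ι : Type*} [Fintype ι] {k : ℕ} (c : ι → ℂ) (R : Fin k → ι → ℝ) (a : ℂ)
    (f : (Fin k → ℂ) → ℂ) :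
    iterInt k (fun i => multiCircle c (R i)) (fun w => a * f w) =
      a * iterInt k (fun i => multiCircle c (R i)) f := by
  induction k with
  | zero => rfl
  | succ k ih =>
    unfold iterInt
    rw [← multiCircle_const_mul]
    congr 1
    funext z
    exact ih (fun i => R i.succ) _

theorem continuous_iterInt {ι : Type*} [Fintype ι] {k : ℕ} {X : Type} [TopologicalSpace X]
    (c : ι → ℂ)
    (R : Fin k → ι → ℝ) (hR : ∀ i j, 0 ≤ R i j) (h : X → (Fin k → ℂ) → ℂ)
    (hh : ContinuousOn (fun p : X × (Fin k → ℂ) => h p.1 p.2) (Set.univ ×ˢ contourBox c R)) :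
    Continuous fun x => iterInt k (fun i => multiCircle c (R i)) (h x) := by
  induction k generalizing X with
  | zero =>
    refine hh.comp_continuous (continuous_id.prodMk continuous_const) fun x => ?_
    exact ⟨Set.mem_univ _, fun i => i.elim0⟩
  | succ k ih =>
    unfold iterInt multiCircle
    refine continuous_finsetSum _ fun j _ => continuous_circleIntegral
      (fun x z => iterInt k (fun i => multiCircle c (R i.succ)) fun w => h x (Fin.cons z w)) _ _ ?_
    refine ih (fun i => R i.succ) (fun i => hR _)
      (fun (p : X × ℝ) w => h p.1 (Fin.cons (circleMap (c j) (R 0 j) p.2) w)) ?_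
    have hcont : Continuous fun p : (X × ℝ) × (Fin k → ℂ) =>
        (p.1.1, (Fin.cons (circleMap (c j) (R 0 j) p.1.2) p.2 : Fin (k + 1) → ℂ)) :=
      (continuous_fst.comp continuous_fst).prodMk ((continuous_cons k).comp
        (((continuous_circleMap _ _).comp (continuous_snd.comp continuous_fst)).prodMk
          continuous_snd))
    refine hh.comp hcont.continuousOn ?_
    · rintro ⟨p, w⟩ ⟨_, hw⟩
      exact ⟨Set.mem_univ _, cons_mem_contourBox (circleMap_mem_circles c _ (hR 0) j _) hw⟩

theorem continuousOn_iterInt {ι : Type*} [Fintype ι] {k : ℕ} (c : ι → ℂ)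
    (R : Fin k → ι → ℝ) (hR : ∀ i j, 0 ≤ R i j) (S : Set ℂ) (h : ℂ → (Fin k → ℂ) → ℂ)
    (hh : ContinuousOn (fun p : ℂ × (Fin k → ℂ) => h p.1 p.2) (S ×ˢ contourBox c R)) :
    ContinuousOn (fun x => iterInt k (fun i => multiCircle c (R i)) (h x)) S := by
  rw [continuousOn_iff_continuous_domRestrict]
  refine continuous_iterInt c R hR (fun (x : S) w => h x w) ?_
  have hcont : Continuous fun p : S × (Fin k → ℂ) => ((p.1 : ℂ), p.2) :=
    (continuous_subtype_val.comp continuous_fst).prodMk continuous_snd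
  exact hh.comp hcont.continuousOn fun p hp => ⟨p.1.2, hp.2⟩

theorem iterInt_add {ι : Type*} [Fintype ι] {k : ℕ} (c : ι → ℂ) (R : Fin k → ι → ℝ)
    (hR : ∀ i j, 0 ≤ R i j)
    {f g : (Fin k → ℂ) → ℂ} (hf : ContinuousOn f (contourBox c R))
    (hg : ContinuousOn g (contourBox c R)) :
    iterInt k (fun i => multiCircle c (R i)) (fun w => f w + g w) =
      iterInt k (fun i => multiCircle c (R i)) f + iterInt k (fun i => multiCircle c (R i)) g := by
  induction k with
  | zero => rfl
  | succ k ih =>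
    have hcons : ∀ {f : (Fin (k + 1) → ℂ) → ℂ}, ContinuousOn f (contourBox c R) →
        ContinuousOn (fun p : ℂ × (Fin k → ℂ) => f (Fin.cons p.1 p.2))
          (circles c (R 0) ×ˢ contourBox c fun i => R i.succ) := fun hf =>
      hf.comp (continuous_cons k).continuousOn fun p hp =>
        cons_mem_contourBox hp.1 hp.2
    have hslice : ∀ {f : (Fin (k + 1) → ℂ) → ℂ}, ContinuousOn f (contourBox c R) →
        ∀ z ∈ circles c (R 0), ContinuousOn (fun w : Fin k → ℂ => f (Fin.cons z w))
          (contourBox c fun i => R i.succ) := fun hf z hz =>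
      hf.comp ((continuous_cons k).comp
        (continuous_const.prodMk continuous_id)).continuousOn fun w hw =>
        cons_mem_contourBox hz hw
    unfold iterInt
    rw [← multiCircle_add c _ (hR 0)
      (continuousOn_iterInt c (fun i => R i.succ) (fun i => hR _) _ _ (hcons hf))
      (continuousOn_iterInt c (fun i => R i.succ) (fun i => hR _) _ _ (hcons hg))]
    exact multiCircle_congr c _ (hR 0) fun z hz =>
      ih (fun i => R i.succ) (fun i => hR _) (hslice hf z hz) (hslice hg z hz)

theorem iterInt_sum {ι : Type*} [Fintype ι] {k : ℕ} {κ : Type*} (c : ι → ℂ) (R : Fin k → ι → ℝ)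
    (hR : ∀ i j, 0 ≤ R i j)
    (J : Finset κ) (f : κ → (Fin k → ℂ) → ℂ) (hf : ∀ j ∈ J, ContinuousOn (f j) (contourBox c R)) :
    iterInt k (fun i => multiCircle c (R i)) (fun w => ∑ j ∈ J, f j w) =
      ∑ j ∈ J, iterInt k (fun i => multiCircle c (R i)) (f j) := by
  classical
  induction J using Finset.induction_on with
  | empty =>
    simpa using iterInt_const_mul c R 0 fun _ => 0
  | insert a J ha ih =>
    simp only [Finset.sum_insert ha]
    rw [iterInt_add c R hR (hf a (Finset.mem_insert_self _ _))
      (continuousOn_finsetSum _ fun j hj => hf j (Finset.mem_insert_of_mem hj)),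
      ih fun j hj => hf j (Finset.mem_insert_of_mem hj)]

theorem multiCircle_swap {ι : Type*} [Fintype ι] (c : ι → ℂ) (R R' : ι → ℝ) (hR : ∀ j, 0 ≤ R j)
    (hR' : ∀ j, 0 ≤ R' j)
    (F : ℂ → ℂ → ℂ)
    (hF : ContinuousOn (fun p : ℂ × ℂ => F p.1 p.2) (circles c R ×ˢ circles c R')) :
    multiCircle c R (fun z => multiCircle c R' (F z)) =
      multiCircle c R' (fun w => multiCircle c R fun z => F z w) := by
  have hpar : ∀ j j', Continuous fun p : ℝ × ℝ =>
      F (circleMap (c j) (R j) p.1) (circleMap (c j') (R' j') p.2) := fun j j' =>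
    hF.comp_continuous (((continuous_circleMap _ _).comp continuous_fst).prodMk
      ((continuous_circleMap _ _).comp continuous_snd)) fun p =>
      ⟨circleMap_mem_circles c R hR j _, circleMap_mem_circles c R' hR' j' _⟩
  have h1 : ∀ j, ∮ z in C(c j, R j), multiCircle c R' (F z) =
      ∑ j', ∮ z in C(c j, R j), ∮ w in C(c j', R' j'), F z w := fun j =>
    circleIntegral.integral_fun_sum fun j' _ =>
      (continuous_circleIntegral (fun θ w => F (circleMap (c j) (R j) θ) w) _ _
        (hpar j j')).intervalIntegrable _ _
  have h2 : ∀ j', ∮ w in C(c j', R' j'), multiCircle c R (fun z => F z w) =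
      ∑ j, ∮ w in C(c j', R' j'), ∮ z in C(c j, R j), F z w := fun j' =>
    circleIntegral.integral_fun_sum fun j _ =>
      (continuous_circleIntegral (fun θ z => F z (circleMap (c j') (R' j') θ)) _ _
        ((hpar j j').comp continuous_swap)).intervalIntegrable _ _
  rw [multiCircle, multiCircle, Finset.sum_congr rfl fun j _ => h1 j,
    Finset.sum_congr rfl fun j' _ => h2 j', Finset.sum_comm]
  exact Finset.sum_congr rfl fun j' _ => Finset.sum_congr rfl fun j _ =>
    circleIntegral_circleIntegral_swap _ _ _ _ _ (hpar j j')

theorem multiCircle_iterInt_swap {ι : Type*} [Fintype ι] {k : ℕ} (c : ι → ℂ) (R₀ : ι → ℝ)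
    (R : Fin k → ι → ℝ) (hR₀ : ∀ j, 0 ≤ R₀ j) (hR : ∀ i j, 0 ≤ R i j)
    (h : ℂ → (Fin k → ℂ) → ℂ)
    (hh : ContinuousOn (fun p : ℂ × (Fin k → ℂ) => h p.1 p.2)
      (circles c R₀ ×ˢ contourBox c R)) :
    multiCircle c R₀ (fun z => iterInt k (fun i => multiCircle c (R i)) (h z)) =
      iterInt k (fun i => multiCircle c (R i)) fun w => multiCircle c R₀ fun z => h z w := by
  induction k with
  | zero => rfl
  | succ k ih =>
    unfold iterInt
    rw [multiCircle_swap c R₀ (R 0) hR₀ (hR 0)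
      (fun z x => iterInt k (fun i => multiCircle c (R i.succ)) fun w => h z (Fin.cons x w))]
    · refine multiCircle_congr c _ (hR 0) fun x hx =>
        ih (fun i => R i.succ) (fun i => hR _) (fun z w => h z (Fin.cons x w)) ?_
      refine hh.comp (continuous_fst.prodMk ((continuous_cons k).comp
        (continuous_const.prodMk continuous_snd))).continuousOn fun p hp => ?_
      exact ⟨hp.1, cons_mem_contourBox hx hp.2⟩
    · rw [continuousOn_iff_continuous_domRestrict]
      refine continuous_iterInt c (fun i => R i.succ) (fun i => hR _)
        (fun (p : (circles c R₀ ×ˢ circles c (R 0) : Set (ℂ × ℂ))) w =>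
          h p.1.1 (Fin.cons p.1.2 w)) ?_
      have hcont : Continuous fun p : (circles c R₀ ×ˢ circles c (R 0) : Set (ℂ × ℂ)) ×
          (Fin k → ℂ) => (p.1.1.1, (Fin.cons p.1.1.2 p.2 : Fin (k + 1) → ℂ)) := by
        have hv : Continuous fun p : (circles c R₀ ×ˢ circles c (R 0) : Set (ℂ × ℂ)) ×
          (Fin k → ℂ) => p.1.1 := continuous_subtype_val.comp continuous_fst
        exact (continuous_fst.comp hv).prodMk ((continuous_cons k).comp
          ((continuous_snd.comp hv).prodMk continuous_snd))
      exact hh.comp hcont.continuousOn fun p hp =>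
        ⟨p.1.2.1, cons_mem_contourBox p.1.2.2 hp.2⟩
/-- The one-variable factor of the integrand, with poles at the points `(u j)⁻¹`, `j ∈ I`. -/
def poleFactor (q s : ℂ) {ι : Type*} (u : ι → ℂ) (I : Finset ι) (m : ℕ) (z : ℂ) : ℂ :=
  z⁻¹ * ((1 - s * z) / (1 - s⁻¹ * z)) ^ m * ∏ j ∈ I, (1 - q * u j * z) / (1 - u j * z)

/-- The interaction between one variable and the subsequent ones. -/
def crossFactor (q : ℂ) {k : ℕ} (w : Fin k → ℂ) (z : ℂ) : ℂ :=
  ∏ b, (z - w b) / (z - q * w b)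

/-- The integrand of the nested contour integral. -/
def nestedIntegrand (q s : ℂ) {ι : Type*} (u : ι → ℂ) (I : Finset ι) {l : ℕ} (y : Fin l → ℕ)
    (w : Fin l → ℂ) : ℂ :=
  (∏ p ∈ (Finset.univ : Finset (Fin l × Fin l)).filter (fun p => p.1 < p.2),
    (w p.1 - w p.2) / (w p.1 - q * w p.2)) * ∏ i, poleFactor q s u I (y i) (w i)

theorem nestedIntegrand_cons (q s : ℂ) {ι : Type*} (u : ι → ℂ) (I : Finset ι) {l : ℕ}
    (y : Fin (l + 1) → ℕ) (z : ℂ) (w : Fin l → ℂ) :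
    nestedIntegrand q s u I y (Fin.cons z w : Fin (l + 1) → ℂ) =
      crossFactor q w z * poleFactor q s u I (y 0) z * nestedIntegrand q s u I (Fin.tail y) w := by
  unfold nestedIntegrand crossFactor
  rw [Finset.prod_filter, Finset.prod_filter, Fintype.prod_prod_type, Fintype.prod_prod_type]
  simp only [Fin.prod_univ_succ, Fin.cons_zero, Fin.cons_succ, Fin.succ_lt_succ_iff, Fin.succ_pos,
    if_true, if_false, Fin.not_lt_zero, one_mul, Fin.tail]
  ring

/-- The centers of the circles: the origin and the points `(u j)⁻¹`. -/
def contourCenter {ι : Type*} (u : ι → ℂ) (o : Option ι) : ℂ := o.elim 0 fun j => (u j)⁻¹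

/-- The radii of the circles: `R` around the origin and `δ` around the other centers. -/
def contourRadius {ι : Type*} (δ R : ℝ) (o : Option ι) : ℝ := o.elim R fun _ => δ

/-- The union of the closed discs bounded by the contours. -/
def contourDiscs {ι : Type*} (u : ι → ℂ) (δ R : ℝ) : Set ℂ :=
  ⋃ o, Metric.closedBall (contourCenter u o) (contourRadius δ R o)

/-- Each disc bounded by a contour contains only the intended pole of the integrand. -/
structure AdmissibleRadii (s : ℂ) {ι : Type*} (u : ι → ℂ) (δ R : ℝ) : Prop where
  delta_pos : 0 < δ
  radius_pos : 0 < R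
  jump_ne : ∀ z ∈ contourDiscs u δ R, 1 - s⁻¹ * z ≠ 0
  ne_zero : ∀ j, ∀ z ∈ Metric.closedBall (u j)⁻¹ δ, z ≠ 0
  pole_ne : ∀ j, ∀ z ∈ Metric.closedBall (u j)⁻¹ δ, ∀ k ≠ j, 1 - u k * z ≠ 0
  pole_ne_zero : ∀ z ∈ Metric.closedBall (0 : ℂ) R, ∀ k, 1 - u k * z ≠ 0

namespace AdmissibleRadii

variable {s : ℂ} {ι : Type*} {u : ι → ℂ} {δ R : ℝ}

theorem contourRadius_nonneg (h : AdmissibleRadii s u δ R) (o : Option ι) :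
    0 ≤ contourRadius δ R o := by
  cases o with
  | none => exact h.radius_pos.le
  | some j => exact h.delta_pos.le

theorem circles_subset : circles (contourCenter u) (contourRadius δ R) ⊆ contourDiscs u δ R :=
  Set.iUnion_mono fun _ => Metric.sphere_subset_closedBall

theorem closedBall_zero_subset : Metric.closedBall 0 R ⊆ contourDiscs u δ R :=
  Set.subset_iUnion (fun o => Metric.closedBall (contourCenter u o) (contourRadius δ R o)) none

theorem closedBall_subset (j : ι) : Metric.closedBall (u j)⁻¹ δ ⊆ contourDiscs u δ R :=
  Set.subset_iUnion (fun o => Metric.closedBall (contourCenter u o) (contourRadius δ R o)) (some j)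

theorem ne_zero_of_mem_circles (h : AdmissibleRadii s u δ R) {z : ℂ}
    (hz : z ∈ circles (contourCenter u) (contourRadius δ R)) : z ≠ 0 := by
  obtain ⟨o, ho⟩ := Set.mem_iUnion.1 hz
  cases o with
  | none => exact Metric.ne_of_mem_sphere ho h.radius_pos.ne'
  | some j => exact h.ne_zero j z (Metric.sphere_subset_closedBall ho)

theorem pole_ne_of_mem_circles (h : AdmissibleRadii s u δ R) {z : ℂ}
    (hz : z ∈ circles (contourCenter u) (contourRadius δ R)) (k : ι) : 1 - u k * z ≠ 0 := by
  obtain ⟨o, ho⟩ := Set.mem_iUnion.1 hz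
  cases o with
  | none => exact h.pole_ne_zero z (Metric.sphere_subset_closedBall ho) k
  | some j =>
    by_cases hkj : k = j
    · subst hkj
      intro h0
      refine Metric.ne_of_mem_sphere ho h.delta_pos.ne' ?_
      exact eq_inv_of_mul_eq_one_right (sub_eq_zero.1 h0).symm
    · exact h.pole_ne j z (Metric.sphere_subset_closedBall ho) k hkj

theorem continuousOn_poleFactor (h : AdmissibleRadii s u δ R) (q : ℂ) (I : Finset ι) (m : ℕ) :
    ContinuousOn (poleFactor q s u I m) (circles (contourCenter u) (contourRadius δ R)) := by
  unfold poleFactor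
  refine ContinuousOn.mul (ContinuousOn.mul ?_ (ContinuousOn.pow ?_ m)) ?_
  · exact continuousOn_id.inv₀ fun z hz => h.ne_zero_of_mem_circles hz
  · exact ContinuousOn.div (by fun_prop) (by fun_prop) fun z hz => h.jump_ne z (circles_subset hz)
  · exact continuousOn_finsetProd _ fun j _ => ContinuousOn.div (by fun_prop) (by fun_prop)
      fun z hz => h.pole_ne_of_mem_circles hz j

end AdmissibleRadii

theorem continuousOn_nestedIntegrand (q : ℂ) {s : ℂ} {ι : Type*} {u : ι → ℂ} {δ : ℝ} {l : ℕ}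
    {R : Fin l → ℝ} (hR : ∀ i, AdmissibleRadii s u δ (R i))
    (hsep : ∀ i j, i < j → ∀ z ∈ contourDiscs u δ (R i),
      ∀ w ∈ circles (contourCenter u) (contourRadius δ (R j)), z - q * w ≠ 0)
    (I : Finset ι) (y : Fin l → ℕ) :
    ContinuousOn (nestedIntegrand q s u I y)
      (contourBox (contourCenter u) fun i => contourRadius δ (R i)) := by
  unfold nestedIntegrand
  refine ContinuousOn.mul ?_ ?_
  · refine continuousOn_finsetProd _ fun p hp => ContinuousOn.div (by fun_prop) (by fun_prop)
      fun w hw => ?_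
    exact hsep _ _ (Finset.mem_filter.1 hp).2 _ (AdmissibleRadii.circles_subset (hw p.1)) _ (hw p.2)
  · exact continuousOn_finsetProd _ fun i _ => ((hR i).continuousOn_poleFactor q I (y i)).comp
      (continuous_apply i).continuousOn fun w hw => hw i

theorem differentiableOn_crossFactor (q : ℂ) {k : ℕ} (w : Fin k → ℂ) (S : Set ℂ)
    (h : ∀ z ∈ S, ∀ b, z - q * w b ≠ 0) : DifferentiableOn ℂ (crossFactor q w) S := by
  unfold crossFactor
  exact DifferentiableOn.fun_finsetProd fun b _ =>
    DifferentiableOn.div (by fun_prop) (by fun_prop) fun z hz => h z hz b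

section Residues

variable {q s : ℂ} {ι : Type*} {u : ι → ℂ} {δ R : ℝ}

theorem circleIntegral_zero_center (hq : q ≠ 0) (h : AdmissibleRadii s u δ R) {k : ℕ}
    (w : Fin k → ℂ) (hw : ∀ b, w b ≠ 0) (hsep : ∀ z ∈ contourDiscs u δ R, ∀ b, z - q * w b ≠ 0)
    (I : Finset ι) (m : ℕ) :
    ∮ z in C(0, R), crossFactor q w z * poleFactor q s u I m z =
      2 * Real.pi * Complex.I * (q⁻¹) ^ k := by
  have hd : DifferentiableOn ℂ (fun z => crossFactor q w z * (((1 - s * z) / (1 - s⁻¹ * z)) ^ m *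
      ∏ j ∈ I, (1 - q * u j * z) / (1 - u j * z))) (Metric.closedBall 0 R) := by
    refine (differentiableOn_crossFactor q w _ fun z hz =>
      hsep z (AdmissibleRadii.closedBall_zero_subset hz)).mul
      (DifferentiableOn.mul (DifferentiableOn.pow (DifferentiableOn.div (by fun_prop) (by fun_prop)
        fun z hz => h.jump_ne z (AdmissibleRadii.closedBall_zero_subset hz)) m) ?_)
    exact DifferentiableOn.fun_finsetProd fun j _ =>
      DifferentiableOn.div (by fun_prop) (by fun_prop) fun z hz => h.pole_ne_zero z hz j
  have key := (hd.mono (Metric.closure_ball_subset_closedBall)).diffContOnCl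
    |>.circleIntegral_sub_inv_smul (Metric.mem_ball_self h.radius_pos)
  have hval : crossFactor q w 0 = (q⁻¹) ^ k := by
    unfold crossFactor
    rw [Finset.prod_congr rfl (g := fun _ => q⁻¹), Finset.prod_const, Finset.card_univ,
      Fintype.card_fin]
    intro b _
    have := hw b
    field_simp
    simp
  simp only [hval, mul_zero, sub_zero, div_one, one_pow, Finset.prod_const_one, mul_one,
    smul_eq_mul] at key
  rw [← key]
  congr 1
  funext z
  unfold poleFactor
  ring

theorem circleIntegral_inv_center [DecidableEq ι] (h : AdmissibleRadii s u δ R)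
    (hu0 : ∀ j, u j ≠ 0) (hs : s ≠ 0) {k : ℕ} (w : Fin k → ℂ)
    (hsep : ∀ z ∈ contourDiscs u δ R, ∀ b, z - q * w b ≠ 0)
    (I : Finset ι) (m : ℕ) {j : ι} (hj : j ∈ I) :
    ∮ z in C((u j)⁻¹, δ), crossFactor q w z * poleFactor q s u I m z =
      2 * Real.pi * Complex.I * (-((1 - q) * (jumpRatio s u j ^ m *
        (∏ b ∈ I.erase j, scat q u j b) * crossFactor q w (u j)⁻¹))) := by
  have hd : DifferentiableOn ℂ (fun z => crossFactor q w z * (((1 - s * z) / (1 - s⁻¹ * z)) ^ m *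
      (∏ b ∈ I.erase j, (1 - q * u b * z) / (1 - u b * z)) *
        (z⁻¹ * ((1 - q * u j * z) * -(u j)⁻¹)))) (Metric.closedBall (u j)⁻¹ δ) := by
    refine (differentiableOn_crossFactor q w _ fun z hz =>
      hsep z (AdmissibleRadii.closedBall_subset j hz)).mul
      (DifferentiableOn.mul (DifferentiableOn.mul (DifferentiableOn.pow (DifferentiableOn.div
        (by fun_prop) (by fun_prop) fun z hz =>
          h.jump_ne z (AdmissibleRadii.closedBall_subset j hz)) m) ?_) ?_)
    · exact DifferentiableOn.fun_finsetProd fun b hb =>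
        DifferentiableOn.div (by fun_prop) (by fun_prop) fun z hz =>
          h.pole_ne j z hz b (Finset.ne_of_mem_erase hb)
    · exact DifferentiableOn.mul (differentiableOn_id.inv fun z hz => h.ne_zero j z hz)
        (by fun_prop)
  have key := (hd.mono (Metric.closure_ball_subset_closedBall)).diffContOnCl
    |>.circleIntegral_sub_inv_smul (Metric.mem_ball_self h.delta_pos)
  have hsu : 1 - s⁻¹ * (u j)⁻¹ ≠ 0 := h.jump_ne _ (AdmissibleRadii.closedBall_subset j
    (Metric.mem_closedBall_self h.delta_pos.le))
  have huj := hu0 j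
  have hjump : (1 - s * (u j)⁻¹) / (1 - s⁻¹ * (u j)⁻¹) = jumpRatio s u j := by
    have h1 : 1 - s * u j ≠ 0 := by
      intro h0
      apply hsu
      rw [← mul_inv, ← sub_eq_zero.1 h0, inv_one, sub_self]
    unfold jumpRatio
    rw [div_eq_div_iff hsu h1]
    field_simp
    ring
  have hscat : ∏ b ∈ I.erase j, (1 - q * u b * (u j)⁻¹) / (1 - u b * (u j)⁻¹) =
      ∏ b ∈ I.erase j, scat q u j b := by
    refine Finset.prod_congr rfl fun b _ => ?_
    unfold scat
    rw [← mul_div_mul_left _ _ huj]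
    congr 1 <;> field_simp
  rw [hjump, hscat] at key
  have hlast : (u j)⁻¹⁻¹ * ((1 - q * u j * (u j)⁻¹) * -(u j)⁻¹) = -(1 - q) := by
    field_simp
  rw [hlast] at key
  simp only [smul_eq_mul] at key
  rw [show ∀ a b c d e : ℂ, a * (-(b * (c * d * e))) = a * (e * (c * d * -b)) from
    fun a b c d e => by ring, ← key]
  refine circleIntegral.integral_congr h.delta_pos.le fun z hz => ?_
  have hz1 : z - (u j)⁻¹ ≠ 0 := sub_ne_zero.2 (Metric.ne_of_mem_sphere hz h.delta_pos.ne')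
  have hz2 : 1 - u j * z = -(u j * (z - (u j)⁻¹)) := by
    field_simp
    ring
  unfold poleFactor
  rw [← Finset.mul_prod_erase I _ hj, hz2]
  rw [div_neg, div_eq_mul_inv _ (u j * _), mul_inv (u j)]
  ring

theorem circleIntegral_inv_center_eq_zero (h : AdmissibleRadii s u δ R) {k : ℕ} (w : Fin k → ℂ)
    (hsep : ∀ z ∈ contourDiscs u δ R, ∀ b, z - q * w b ≠ 0)
    (I : Finset ι) (m : ℕ) {j : ι} (hj : j ∉ I) :
    ∮ z in C((u j)⁻¹, δ), crossFactor q w z * poleFactor q s u I m z = 0 := by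
  have hd : DifferentiableOn ℂ (fun z => crossFactor q w z * poleFactor q s u I m z)
      (Metric.closedBall (u j)⁻¹ δ) := by
    unfold poleFactor
    refine (differentiableOn_crossFactor q w _ fun z hz =>
      hsep z (AdmissibleRadii.closedBall_subset j hz)).mul
      (DifferentiableOn.mul (DifferentiableOn.mul ?_ (DifferentiableOn.pow (DifferentiableOn.div
        (by fun_prop) (by fun_prop) fun z hz =>
          h.jump_ne z (AdmissibleRadii.closedBall_subset j hz)) m)) ?_)
    · exact differentiableOn_id.inv fun z hz => h.ne_zero j z hz
    · exact DifferentiableOn.fun_finsetProd fun b hb =>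
        DifferentiableOn.div (by fun_prop) (by fun_prop) fun z hz =>
          h.pole_ne j z hz b fun e => hj (e ▸ hb)
  refine Complex.circleIntegral_eq_zero_of_differentiable_on_off_countable h.delta_pos.le
    Set.countable_empty hd.continuousOn fun z hz => ?_
  exact (hd.mono Metric.ball_subset_closedBall).differentiableAt (Metric.isOpen_ball.mem_nhds hz.1)

theorem multiCircle_crossFactor_mul_poleFactor [Fintype ι] [DecidableEq ι] (hq : q ≠ 0)
    (hs : s ≠ 0) (hu0 : ∀ j, u j ≠ 0) (h : AdmissibleRadii s u δ R) {k : ℕ} (w : Fin k → ℂ)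
    (hw : ∀ b, w b ≠ 0) (hsep : ∀ z ∈ contourDiscs u δ R, ∀ b, z - q * w b ≠ 0)
    (I : Finset ι) (m : ℕ) :
    multiCircle (contourCenter u) (contourRadius δ R)
        (fun z => crossFactor q w z * poleFactor q s u I m z) =
      2 * Real.pi * Complex.I * ((q⁻¹) ^ k - (1 - q) * ∑ j ∈ I, jumpRatio s u j ^ m *
        (∏ b ∈ I.erase j, scat q u j b) * crossFactor q w (u j)⁻¹) := by
  have hsum : ∑ j, ∮ z in C((u j)⁻¹, δ), crossFactor q w z * poleFactor q s u I m z =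
      ∑ j ∈ I, 2 * Real.pi * Complex.I * (-((1 - q) * (jumpRatio s u j ^ m *
        (∏ b ∈ I.erase j, scat q u j b) * crossFactor q w (u j)⁻¹))) := by
    rw [← Finset.sum_subset (Finset.subset_univ I)
      fun j _ hj => circleIntegral_inv_center_eq_zero h w hsep I m hj]
    exact Finset.sum_congr rfl fun j hj => circleIntegral_inv_center h hu0 hs w hsep I m hj
  unfold multiCircle
  rw [Fintype.sum_option]
  simp only [contourCenter, contourRadius, Option.elim_none, Option.elim_some]
  rw [circleIntegral_zero_center hq h w hw hsep I m, hsum, ← Finset.mul_sum, Finset.sum_neg_distrib,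
    ← Finset.mul_sum]
  ring

end Residues

theorem crossFactor_mul_nestedIntegrand (q s : ℂ) {ι : Type*} [DecidableEq ι] (u : ι → ℂ)
    (I : Finset ι) {j : ι} (hj : j ∈ I) (hu0 : u j ≠ 0) {l : ℕ} (y : Fin l → ℕ) (w : Fin l → ℂ)
    (hw : ∀ i, 1 - u j * w i ≠ 0) (hqw : ∀ i, (u j)⁻¹ - q * w i ≠ 0) :
    crossFactor q w (u j)⁻¹ * nestedIntegrand q s u I y w =
      nestedIntegrand q s u (I.erase j) y w := by
  unfold nestedIntegrand crossFactor
  rw [mul_left_comm, ← Finset.prod_mul_distrib]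
  congr 1
  refine Finset.prod_congr rfl fun i _ => ?_
  unfold poleFactor
  rw [← Finset.mul_prod_erase I _ hj]
  have h1 : ((u j)⁻¹ - w i) / ((u j)⁻¹ - q * w i) *
      ((1 - q * u j * w i) / (1 - u j * w i)) = 1 := by
    have e1 : (u j)⁻¹ - w i = (u j)⁻¹ * (1 - u j * w i) := by
      field_simp
    have e2 : 1 - q * u j * w i = u j * ((u j)⁻¹ - q * w i) := by
      field_simp
    rw [e1, e2]
    have := hw i
    have := hqw i
    rw [div_mul_div_comm, div_eq_one_iff_eq (mul_ne_zero ‹_› ‹_›)]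
    field_simp
  linear_combination ((w i)⁻¹ * ((1 - s * w i) / (1 - s⁻¹ * w i)) ^ (y i) *
    ∏ b ∈ I.erase j, (1 - q * u b * w i) / (1 - u b * w i)) * h1

theorem iterInt_nestedIntegrand {q s : ℂ} (hq : q ≠ 0) (hs : s ≠ 0) {ι : Type*} [Fintype ι]
    [DecidableEq ι] {u : ι → ℂ} (hu0 : ∀ j, u j ≠ 0) {δ : ℝ} {l : ℕ} (R : Fin l → ℝ)
    (hR : ∀ i, AdmissibleRadii s u δ (R i))
    (hsep : ∀ i j, i < j → ∀ z ∈ contourDiscs u δ (R i),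
      ∀ w ∈ circles (contourCenter u) (contourRadius δ (R j)), z - q * w ≠ 0)
    (I : Finset ι) (y : Fin l → ℕ) :
    q ^ (l * (l - 1) / 2) * iterInt l
        (fun i => multiCircle (contourCenter u) (contourRadius δ (R i)))
        (nestedIntegrand q s u I y) =
      (2 * Real.pi * Complex.I) ^ l * residueSum q s u l y I := by
  induction l generalizing I with
  | zero => simp [iterInt, nestedIntegrand, residueSum]
  | succ l ih =>
    have hnn : ∀ i j, 0 ≤ contourRadius δ (R i) j := fun i => (hR i).contourRadius_nonneg
    have hR' : ∀ i : Fin l, AdmissibleRadii s u δ (R i.succ) := fun i => hR _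
    have hsep' : ∀ i j : Fin l, i < j → ∀ z ∈ contourDiscs u δ (R i.succ),
        ∀ w ∈ circles (contourCenter u) (contourRadius δ (R j.succ)), z - q * w ≠ 0 :=
      fun i j hij => hsep _ _ (Fin.succ_lt_succ_iff.2 hij)
    have hcont : ∀ J, ContinuousOn (nestedIntegrand q s u J (Fin.tail y))
        (contourBox (contourCenter u) fun i : Fin l => contourRadius δ (R i.succ)) :=
      fun J => continuousOn_nestedIntegrand q hR' hsep' J _
    have hswap := multiCircle_iterInt_swap (contourCenter u) (contourRadius δ (R 0))
      (fun i : Fin l => contourRadius δ (R i.succ)) (hnn 0) (fun i => hnn _)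
      (fun z w => nestedIntegrand q s u I y (Fin.cons z w : Fin (l + 1) → ℂ))
      ((continuousOn_nestedIntegrand q hR hsep I y).comp (continuous_cons l).continuousOn
        fun p hp => cons_mem_contourBox hp.1 hp.2)
    have hstep : iterInt (l + 1) (fun i => multiCircle (contourCenter u) (contourRadius δ (R i)))
        (nestedIntegrand q s u I y) = _ := hswap
    rw [hstep]
    have hinner : Set.EqOn (fun w : Fin l → ℂ => multiCircle (contourCenter u)
          (contourRadius δ (R 0)) fun z =>
            nestedIntegrand q s u I y (Fin.cons z w : Fin (l + 1) → ℂ))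
        (fun w => 2 * Real.pi * Complex.I * ((q⁻¹) ^ l * nestedIntegrand q s u I (Fin.tail y) w +
          -(1 - q) * ∑ j ∈ I, jumpRatio s u j ^ (y 0) * (∏ b ∈ I.erase j, scat q u j b) *
            nestedIntegrand q s u (I.erase j) (Fin.tail y) w))
        (contourBox (contourCenter u) fun i : Fin l => contourRadius δ (R i.succ)) := by
      intro w hw
      have hsw : ∀ z ∈ contourDiscs u δ (R 0), ∀ b, z - q * w b ≠ 0 := fun z hz b =>
        hsep 0 b.succ (Fin.succ_pos b) z hz _ (hw b)
      simp only [nestedIntegrand_cons]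
      have e1 : ∀ z, crossFactor q w z * poleFactor q s u I (y 0) z *
          nestedIntegrand q s u I (Fin.tail y) w = nestedIntegrand q s u I (Fin.tail y) w *
          (crossFactor q w z * poleFactor q s u I (y 0) z) := fun z => mul_comm _ _
      simp only [e1]
      rw [multiCircle_const_mul, multiCircle_crossFactor_mul_poleFactor hq hs hu0 (hR 0) w
        (fun b => (hR' b).ne_zero_of_mem_circles (hw b)) hsw]
      have e2 : ∀ j ∈ I, jumpRatio s u j ^ (y 0) * (∏ b ∈ I.erase j, scat q u j b) *
            nestedIntegrand q s u (I.erase j) (Fin.tail y) w =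
          jumpRatio s u j ^ (y 0) * (∏ b ∈ I.erase j, scat q u j b) * crossFactor q w (u j)⁻¹ *
            nestedIntegrand q s u I (Fin.tail y) w := by
        intro j hj
        rw [← crossFactor_mul_nestedIntegrand q s u I hj (hu0 j) (Fin.tail y) w
          (fun i => (hR' i).pole_ne_of_mem_circles (hw i) j) (fun i => hsw _
            (AdmissibleRadii.closedBall_subset j
              (Metric.mem_closedBall_self (hR 0).delta_pos.le)) i)]
        ring
      rw [Finset.sum_congr rfl e2, ← Finset.sum_mul]
      ring
    rw [iterInt_congr _ _ (fun i => hnn _) hinner, iterInt_const_mul, iterInt_add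
        (f := fun w => (q⁻¹) ^ l * nestedIntegrand q s u I (Fin.tail y) w)
        (g := fun w => -(1 - q) * ∑ j ∈ I, jumpRatio s u j ^ (y 0) *
          (∏ b ∈ I.erase j, scat q u j b) * nestedIntegrand q s u (I.erase j) (Fin.tail y) w)
        _ _ (fun i => hnn _) (continuousOn_const.mul (hcont I)) (continuousOn_const.mul
        (continuousOn_finsetSum _ fun j _ => continuousOn_const.mul (hcont _))),
      iterInt_const_mul, iterInt_const_mul, iterInt_sum _ _ (fun i => hnn _) I
        (fun j w => jumpRatio s u j ^ (y 0) * (∏ b ∈ I.erase j, scat q u j b) *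
          nestedIntegrand q s u (I.erase j) (Fin.tail y) w)
        (fun j _ => continuousOn_const.mul (hcont _))]
    simp only [iterInt_const_mul]
    have ih' := fun J => ih (fun i => R i.succ) hR' hsep' J (Fin.tail y)
    have hq1 : q ^ l * (q⁻¹) ^ l = 1 := by
      rw [← mul_pow, mul_inv_cancel₀ hq, one_pow]
    rw [Nat.triangle_succ, pow_add, residueSum, pow_succ]
    set N := fun J => iterInt l (fun i => multiCircle (contourCenter u)
      (contourRadius δ (R i.succ))) (nestedIntegrand q s u J (Fin.tail y)) with hN
    have e3 : (2 * Real.pi * Complex.I) ^ l * ∑ j ∈ I, jumpRatio s u j ^ (y 0) *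
          (∏ b ∈ I.erase j, scat q u j b) * residueSum q s u l (Fin.tail y) (I.erase j) =
        q ^ (l * (l - 1) / 2) * ∑ j ∈ I, jumpRatio s u j ^ (y 0) *
          (∏ b ∈ I.erase j, scat q u j b) * N (I.erase j) := by
      rw [Finset.mul_sum, Finset.mul_sum]
      refine Finset.sum_congr rfl fun j _ => ?_
      linear_combination (-(jumpRatio s u j ^ (y 0) * (∏ b ∈ I.erase j, scat q u j b))) *
        ih' (I.erase j)
    have e4 := ih' I
    change q ^ (l * (l - 1) / 2) * q ^ l * (2 * Real.pi * Complex.I * (q⁻¹ ^ l * N I +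
      -(1 - q) * ∑ j ∈ I, jumpRatio s u j ^ (y 0) * (∏ b ∈ I.erase j, scat q u j b) *
        N (I.erase j))) = _
    change q ^ (l * (l - 1) / 2) * N I = _ at e4
    linear_combination (2 * Real.pi * Complex.I) * e4 + (2 * Real.pi * Complex.I) *
      (1 - q) * q ^ l * e3 + (2 * Real.pi * Complex.I) * q ^ (l * (l - 1) / 2) * N I * hq1

theorem exists_pos_forall_le {κ : Type*} [Finite κ] (f : κ → ℝ) (hf : ∀ k, 0 < f k) :
    ∃ m, 0 < m ∧ ∀ k, m ≤ f k := by
  cases isEmpty_or_nonempty κ with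
  | inl _ => exact ⟨1, one_pos, fun k => isEmptyElim k⟩
  | inr _ =>
    obtain ⟨k₀, hk₀⟩ := Finite.exists_min f
    exact ⟨f k₀, hf k₀, hk₀⟩

section RealParameters

variable {q s : ℝ} {ι : Type*} {u : ι → ℝ} {δ R m : ℝ}

theorem half_lt_re_of_mem_closedBall (hm : ∀ j, m ≤ (u j)⁻¹) (hδm : δ < m / 2) {j : ι} {z : ℂ}
    (hz : z ∈ Metric.closedBall ((u j : ℂ))⁻¹ δ) : m / 2 < z.re := by
  have h1 := (Complex.abs_re_le_norm _).trans (mem_closedBall_iff_norm.1 hz)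
  rw [← Complex.ofReal_inv, Complex.sub_re, Complex.ofReal_re] at h1
  have h2 := (abs_le.1 h1).1
  have h3 := hm j
  linarith

theorem half_lt_norm_of_mem_closedBall (hm : ∀ j, m ≤ (u j)⁻¹) (hδm : δ < m / 2) {j : ι} {z : ℂ}
    (hz : z ∈ Metric.closedBall ((u j : ℂ))⁻¹ δ) : m / 2 < ‖z‖ :=
  (half_lt_re_of_mem_closedBall hm hδm hz).trans_le (Complex.re_le_norm z)

theorem admissibleRadii_ofReal (hs : s < 0) (hm : ∀ j, m ≤ (u j)⁻¹) (hδ : 0 < δ)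
    (hδm : δ < m / 2) (hδu : ∀ j k, j ≠ k → δ < |(u j)⁻¹ - (u k)⁻¹|) (hR : 0 < R)
    (hRm : R < m / 2) (hRs : R < -s) : AdmissibleRadii (s : ℂ) (fun j => (u j : ℂ)) δ R where
  delta_pos := hδ
  radius_pos := hR
  jump_ne := by
    intro z hz h0
    have hzs : z = (s : ℂ) := by
      rw [← inv_inv (s : ℂ)]
      exact eq_inv_of_mul_eq_one_right (sub_eq_zero.1 h0).symm
    obtain ⟨o, ho⟩ := Set.mem_iUnion.1 hz
    cases o with
    | none =>
      have h1 := mem_closedBall_iff_norm.1 ho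
      simp only [contourCenter, contourRadius, Option.elim_none, sub_zero, hzs, Complex.norm_real,
        Real.norm_eq_abs, abs_of_neg hs] at h1
      linarith
    | some j =>
      have h1 := half_lt_re_of_mem_closedBall hm hδm ho
      rw [hzs, Complex.ofReal_re] at h1
      linarith
  ne_zero := by
    intro j z hz h0
    have h1 := half_lt_norm_of_mem_closedBall hm hδm hz
    rw [h0, norm_zero] at h1
    linarith
  pole_ne := by
    intro j z hz k hkj h0
    have hzk : z = ((u k : ℂ))⁻¹ := eq_inv_of_mul_eq_one_right (sub_eq_zero.1 h0).symm
    have h1 := mem_closedBall_iff_norm.1 hz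
    rw [hzk, ← Complex.ofReal_inv, ← Complex.ofReal_inv, ← Complex.ofReal_sub, Complex.norm_real,
      Real.norm_eq_abs] at h1
    exact absurd h1 (hδu k j hkj).not_ge
  pole_ne_zero := by
    intro z hz k h0
    have hzk : z = ((u k : ℂ))⁻¹ := eq_inv_of_mul_eq_one_right (sub_eq_zero.1 h0).symm
    have h1 := mem_closedBall_zero_iff.1 hz
    rw [hzk, ← Complex.ofReal_inv, Complex.norm_real] at h1
    have h2 := hm k
    have h3 := Real.le_norm_self (u k)⁻¹
    linarith

theorem sub_mul_ne_zero_of_mem_contours (hq : 0 < q) (hq1 : q < 1) (hm : ∀ j, m ≤ (u j)⁻¹)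
    (hδm : δ < m / 2) (hδq : ∀ j k, (1 + q) * δ < |(u j)⁻¹ - q * (u k)⁻¹|) {R' : ℝ} (hR' : 0 < R')
    (hRR' : R < q * R') (hRm : R < q * (m / 2)) (hRm' : R' < m / 2) {z w : ℂ}
    (hz : z ∈ contourDiscs (fun j => (u j : ℂ)) δ R)
    (hw : w ∈ circles (contourCenter fun j => (u j : ℂ)) (contourRadius δ R')) :
    z - q * w ≠ 0 := by
  intro h0
  have hzw : ‖z‖ = q * ‖w‖ := by
    rw [sub_eq_zero.1 h0, norm_mul, Complex.norm_real, Real.norm_of_nonneg hq.le]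
  obtain ⟨o, ho⟩ := Set.mem_iUnion.1 hz
  obtain ⟨o', ho'⟩ := Set.mem_iUnion.1 hw
  cases o with
  | none =>
    have h1 : ‖z‖ ≤ R := mem_closedBall_zero_iff.1 ho
    cases o' with
    | none =>
      have h2 : ‖w‖ = R' := mem_sphere_zero_iff_norm.1 ho'
      rw [h2] at hzw
      linarith
    | some k =>
      have h2 := half_lt_norm_of_mem_closedBall hm hδm (Metric.sphere_subset_closedBall ho')
      have h3 := mul_lt_mul_of_pos_left h2 hq
      linarith
  | some j =>
    cases o' with
    | none =>
      have h1 := half_lt_norm_of_mem_closedBall hm hδm ho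
      have h2 : ‖w‖ = R' := mem_sphere_zero_iff_norm.1 ho'
      rw [h2] at hzw
      have h3 := mul_lt_mul_of_pos_right hq1 hR'
      linarith
    | some k =>
      have h1 : ‖z - (u j : ℂ)⁻¹‖ ≤ δ := mem_closedBall_iff_norm.1 ho
      have h2 : ‖w - (u k : ℂ)⁻¹‖ = δ := mem_sphere_iff_norm.1 ho'
      refine absurd (hδq j k) (not_lt.2 ?_)
      calc |(u j)⁻¹ - q * (u k)⁻¹| = ‖((u j : ℂ))⁻¹ - q * ((u k : ℂ))⁻¹‖ := by
            rw [← Real.norm_eq_abs, ← Complex.norm_real]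
            push_cast
            rfl
        _ = ‖(q : ℂ) * (w - (u k : ℂ)⁻¹) - (z - (u j : ℂ)⁻¹)‖ := by
            congr 1
            linear_combination h0
        _ ≤ ‖(q : ℂ) * (w - (u k : ℂ)⁻¹)‖ + ‖z - (u j : ℂ)⁻¹‖ := norm_sub_le _ _
        _ ≤ (1 + q) * δ := by
            rw [norm_mul, h2, Complex.norm_real, Real.norm_of_nonneg hq.le]
            linarith

theorem jumpRatio_ofReal_eq (s : ℝ) (u : ι → ℝ) (a : ι) :
    jumpRatio (s : ℂ) (fun j => (u j : ℂ)) a = ((-s * (u a - s) / (1 - s * u a) : ℝ) : ℂ) := by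
  unfold jumpRatio
  push_cast
  congr 1
  ring

theorem jumpRatio_ofReal_mem_Ioo (hs : s ∈ Set.Ioo (-1 : ℝ) 0) {x : ℝ} (hx : 0 < x) :
    -s * (x - s) / (1 - s * x) ∈ Set.Ioo (0 : ℝ) 1 := by
  obtain ⟨hs1, hs0⟩ := hs
  have h1 : 0 < 1 - s * x := by nlinarith
  refine ⟨div_pos (by nlinarith) h1, (div_lt_one h1).2 ?_⟩
  nlinarith

/-- Small enough radii are admissible and separate the nested contours. -/
theorem exists_admissible_contours [Finite ι] (hq : q ∈ Set.Ioo (0 : ℝ) 1) (hs : s < 0)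
    (hu : ∀ j, 0 < u j) (hinj : Function.Injective u) (huq : ∀ i j, u i ≠ q * u j) {r : ℝ}
    (hr : q⁻¹ < r) (l : ℕ) :
    ∃ δ₀ : ℝ, 0 < δ₀ ∧ ∃ ρ₀ : ℝ, 0 < ρ₀ ∧ ∀ δ ∈ Set.Ioo (0 : ℝ) δ₀, ∀ ρ ∈ Set.Ioo (0 : ℝ) ρ₀,
      (∀ i : Fin l, AdmissibleRadii (s : ℂ) (fun j => (u j : ℂ)) δ (r ^ ((i : ℕ) + 1) * ρ)) ∧
      ∀ i j : Fin l, i < j →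
        ∀ z ∈ contourDiscs (fun j => (u j : ℂ)) δ (r ^ ((i : ℕ) + 1) * ρ),
        ∀ w ∈ circles (contourCenter fun j => (u j : ℂ))
          (contourRadius δ (r ^ ((j : ℕ) + 1) * ρ)), z - q * w ≠ 0 := by
  obtain ⟨hq0, hq1⟩ := hq
  have hqr : 1 < q * r := (inv_lt_iff_one_lt_mul₀' hq0).1 hr
  have hr1 : 1 < r := ((one_lt_inv₀ hq0).2 hq1).trans hr
  have hrl : 0 < r ^ l := pow_pos (one_pos.trans hr1) l
  obtain ⟨m, hm0, hm⟩ := exists_pos_forall_le (fun j => (u j)⁻¹) fun j => inv_pos.2 (hu j)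
  obtain ⟨d, hd0, hd⟩ := exists_pos_forall_le (fun p : ι × ι => |(u p.1)⁻¹ - q * (u p.2)⁻¹|)
    fun p => abs_pos.2 fun h => by
      refine huq p.2 p.1 ?_
      have h1 := (hu p.1).ne'
      have h2 := (hu p.2).ne'
      field_simp at h
      linarith
  obtain ⟨e, he0, he⟩ := exists_pos_forall_le
    (fun p : {p : ι × ι // p.1 ≠ p.2} => |(u p.1.1)⁻¹ - (u p.1.2)⁻¹|)
    fun p => abs_pos.2 fun h => p.2 (hinj (inv_injective (sub_eq_zero.1 h)))
  refine ⟨min (m / 2) (min (d / (1 + q)) e), by positivity,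
    min (q * (m / 2)) (-s) / r ^ l, div_pos (lt_min (by positivity) (by linarith)) hrl, ?_⟩
  rintro δ ⟨hδ0, hδ⟩ ρ ⟨hρ0, hρ⟩
  obtain ⟨hδm, hδ'⟩ := lt_min_iff.1 hδ
  obtain ⟨hδd, hδe⟩ := lt_min_iff.1 hδ'
  rw [lt_div_iff₀' (by positivity)] at hδd
  rw [lt_div_iff₀' hrl] at hρ
  obtain ⟨hρm, hρs⟩ := lt_min_iff.1 hρ
  have hR0 : ∀ i : Fin l, 0 < r ^ ((i : ℕ) + 1) * ρ := fun i =>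
    mul_pos (pow_pos (one_pos.trans hr1) _) hρ0
  have hRl : ∀ i : Fin l, r ^ ((i : ℕ) + 1) * ρ ≤ r ^ l * ρ := fun i =>
    mul_le_mul_of_nonneg_right (pow_le_pow_right₀ hr1.le i.isLt) hρ0.le
  have hqm : q * (m / 2) < m / 2 := by nlinarith
  refine ⟨fun i => admissibleRadii_ofReal hs hm hδ0 hδm
    (fun j k hjk => hδe.trans_le (he ⟨(j, k), hjk⟩)) (hR0 i)
    (((hRl i).trans_lt hρm).trans hqm) ((hRl i).trans_lt hρs), fun i j hij z hz w hw => ?_⟩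
  refine sub_mul_ne_zero_of_mem_contours hq0 hq1 hm hδm (fun j k => hδd.trans_le (hd (j, k)))
    (hR0 j) ?_ ((hRl i).trans_lt hρm) (((hRl j).trans_lt hρm).trans hqm) hz hw
  calc r ^ ((i : ℕ) + 1) * ρ < (q * r) * (r ^ ((i : ℕ) + 1) * ρ) := by
        have := hR0 i
        nlinarith
    _ = q * (r ^ ((i : ℕ) + 1 + 1) * ρ) := by ring
    _ ≤ q * (r ^ ((j : ℕ) + 1) * ρ) := by
        have h1 : r ^ ((i : ℕ) + 1 + 1) ≤ r ^ ((j : ℕ) + 1) :=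
          pow_le_pow_right₀ hr1.le (Nat.succ_le_succ hij)
        gcongr

end RealParameters

/-- Theorem 9.8: the multi-point q-moments of the height function of the stochastic higher spin
six vertex model started from the empty configuration, with the contours `γ[ū|j]` realized as
small circles around the points `u_i⁻¹` together with a circle of radius `r^j·ρ` around `0`. -/
theorem multi_point_q_moments (q s : ℝ) (hq : q ∈ Set.Ioo (0 : ℝ) 1)
    (hs : s ∈ Set.Ioo (-1 : ℝ) 0) (n : ℕ) (hn : 1 ≤ n) (u : Fin n → ℝ)
    (hupos : ∀ i, 0 < u i) (huinj : Function.Injective u)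
    (huq : ∀ i j, u i ≠ q * u j) (r : ℝ) (hr : q⁻¹ < r)
    (l : ℕ) (hl : 1 ≤ l) (x : Fin l → ℕ) (hx1 : ∀ i, 1 ≤ x i)
    (hxdec : ∀ i j : Fin l, i ≤ j → x j ≤ x i) :
    ∃ δ₀ : ℝ, 0 < δ₀ ∧ ∃ ρ₀ : ℝ, 0 < ρ₀ ∧
      ∀ δ ∈ Set.Ioo (0 : ℝ) δ₀, ∀ ρ ∈ Set.Ioo (0 : ℝ) ρ₀,
      Summable (fun ν : Sign n =>
        Mwt (q : ℂ) (s : ℂ) (fun i => (u i : ℂ)) ν.1 *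
          ∏ i, (q : ℂ) ^ (height ν.1 (x i))) ∧
      ∑' ν : Sign n,
          Mwt (q : ℂ) (s : ℂ) (fun i => (u i : ℂ)) ν.1 *
            ∏ i, (q : ℂ) ^ (height ν.1 (x i))
        = (q : ℂ) ^ (l * (l - 1) / 2) * (1 / (2 * (Real.pi : ℂ) * Complex.I)) ^ l *
            iterInt l
              (fun i => fun g =>
                (∑ j, ∮ z in C(((u j : ℂ))⁻¹, δ), g z) +
                  ∮ z in C(0, r ^ ((i : ℕ) + 1) * ρ), g z)
              (fun w =>
                (∏ p ∈ (Finset.univ : Finset (Fin l × Fin l)).filter (fun p => p.1 < p.2),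
                  (w p.1 - w p.2) / (w p.1 - (q : ℂ) * w p.2)) *
                ∏ i, ((w i)⁻¹ *
                  ((1 - (s : ℂ) * w i) / (1 - ((s : ℂ))⁻¹ * w i)) ^ (x i - 1) *
                  ∏ j, (1 - (q : ℂ) * (u j : ℂ) * w i) / (1 - (u j : ℂ) * w i))) := by
  obtain ⟨δ₀, hδ₀, ρ₀, hρ₀, hcontours⟩ :=
    exists_admissible_contours hq hs.2 hupos huinj huq hr l
  refine ⟨δ₀, hδ₀, ρ₀, hρ₀, fun δ hδ ρ hρ => ?_⟩
  obtain ⟨hadm, hsep⟩ := hcontours δ hδ ρ hρ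
  have hq0 : (q : ℂ) ≠ 0 := Complex.ofReal_ne_zero.2 hq.1.ne'
  have hs0 : (s : ℂ) ≠ 0 := Complex.ofReal_ne_zero.2 hs.2.ne
  have hu0 : ∀ a, (u a : ℂ) ≠ 0 := fun a => Complex.ofReal_ne_zero.2 (hupos a).ne'
  have hinj : Function.Injective fun a => (u a : ℂ) := Complex.ofReal_injective.comp huinj
  have hqn : ‖(q : ℂ)‖ < 1 := by
    rw [Complex.norm_real, Real.norm_of_nonneg hq.1.le]
    exact hq.2
  have hsu : ∀ a, 1 - (s : ℂ) * (u a : ℂ) ≠ 0 := by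
    intro a
    have h1 : 0 < 1 - s * u a := by nlinarith [mul_neg_of_neg_of_pos hs.2 (hupos a)]
    exact_mod_cast h1.ne'
  have hjump : ∀ a, jumpRatio (s : ℂ) (fun j => (u j : ℂ)) a ≠ 0 := by
    intro a
    rw [jumpRatio_ofReal_eq]
    exact Complex.ofReal_ne_zero.2 (jumpRatio_ofReal_mem_Ioo hs (hupos a)).1.ne'
  have hjump1 : ∀ a, ‖jumpRatio (s : ℂ) (fun j => (u j : ℂ)) a‖ < 1 := by
    intro a
    have h1 := jumpRatio_ofReal_mem_Ioo hs (hupos a)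
    rw [jumpRatio_ofReal_eq, Complex.norm_real, Real.norm_of_nonneg h1.1.le]
    exact h1.2
  have hsum := hasSum_Mwt_mul_heightProd (q : ℂ) (s : ℂ) hqn hs0 (fun a => (u a : ℂ)) hinj hu0 hsu
    hjump hjump1 (fun i => x i - 1) fun i j hij => Nat.sub_le_sub_right (hxdec i j hij) 1
  have hheight : ∀ ν : Fin n → ℕ, heightProd (q : ℂ) (fun i => x i - 1) ν =
      ∏ i, (q : ℂ) ^ height ν (x i) := by
    intro ν
    unfold heightProd
    exact Finset.prod_congr rfl fun i _ => by rw [Nat.sub_add_cancel (hx1 i)]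
  simp only [hheight] at hsum
  refine ⟨hsum.summable, hsum.tsum_eq.trans ?_⟩
  have hint := iterInt_nestedIntegrand hq0 hs0 hu0 (fun i : Fin l => r ^ ((i : ℕ) + 1) * ρ) hadm
    hsep Finset.univ fun i => x i - 1
  have hops : (fun i : Fin l => multiCircle (contourCenter fun a => (u a : ℂ))
      (contourRadius δ (r ^ ((i : ℕ) + 1) * ρ))) = fun (i : Fin l) (g : ℂ → ℂ) =>
        (∑ j, ∮ z in C(((u j : ℂ))⁻¹, δ), g z) + ∮ z in C(0, r ^ ((i : ℕ) + 1) * ρ), g z := by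
    funext i g
    unfold multiCircle
    rw [Fintype.sum_option, add_comm]
    rfl
  rw [hops] at hint
  rw [mul_right_comm]
  refine Eq.trans ?_ (congrArg (· * (1 / (2 * (Real.pi : ℂ) * Complex.I)) ^ l) hint.symm)
  rw [mul_right_comm, ← mul_pow, mul_one_div_cancel Complex.two_pi_I_ne_zero, one_pow, one_mul]

end
end

section
/- Let R be a commutative ring, let q̂ ∈ R, let ℓ ≥ 0, and let X₁,…,X_ℓ ∈ R. Then Σ_{k=0}^ℓ Σ_{I = {i₁ < i₂ < … < i_k} ⊆ {1,…,ℓ}} q̂^{(ℓ−k)(ℓ−k+1)/2} · ∏_{m=1}^{k} (X_{i_m} − q̂^{ i_m − m + 1}) = X₁·X₂⋯X_ℓ. -/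
open Finset

theorem sum_powerset_prod_sub_eq_prod {α R : Type*} [LinearOrder α] [CommRing R]
    (f : ℕ → R) (X : α → R) (s : Finset α) :
    ∑ I ∈ s.powerset, (∏ j ∈ range (#(s \ I)), f j) *
        ∏ i ∈ I, (X i - f (#{j ∈ s \ I | j < i})) = ∏ i ∈ s, X i := by
  induction s using Finset.induction_on_max with
  | empty => simp
  | insert a s hs ih =>
    have ha : a ∉ s := fun h => lt_irrefl a (hs a h)
    rw [sum_powerset_insert ha, prod_insert ha, ← ih, mul_sum, ← sum_add_distrib]
    refine sum_congr rfl fun I hI => ?_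
    have hIs := mem_powerset.mp hI
    have haI : a ∉ I := fun h => ha (hIs h)
    have ha' : a ∉ s \ I := fun h => ha (mem_sdiff.mp h).1
    have below : ∏ i ∈ I, (X i - f (#{j ∈ insert a (s \ I) | j < i})) =
        ∏ i ∈ I, (X i - f (#{j ∈ s \ I | j < i})) :=
      prod_congr rfl fun i hi => by rw [filter_insert, if_neg (hs i (hIs hi)).not_gt]
    have all : {j ∈ s \ I | j < a} = s \ I :=
      filter_true_of_mem fun j hj => hs j (mem_sdiff.mp hj).1
    have hsdiff : insert a s \ insert a I = s \ I := by
      rw [insert_sdiff_insert, sdiff_insert_of_notMem ha]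
    rw [hsdiff, insert_sdiff_of_notMem s haI, card_insert_of_notMem ha', prod_range_succ,
      prod_insert haI, all, below]
    ring

theorem prod_range_pow_succ {M : Type*} [CommMonoid M] (q : M) (n : ℕ) :
    ∏ j ∈ range n, q ^ (j + 1) = q ^ (n * (n + 1) / 2) := by
  have hsum : ∑ j ∈ range n, (j + 1) = n * (n + 1) / 2 := by
    rw [← Finset.sum_range_succ' (fun j => j) n |>.trans (add_zero _), sum_range_id,
      Nat.add_sub_cancel, mul_comm]
  rw [prod_pow_eq_pow_sum, hsum]

theorem card_filter_lt_orderEmbOfFin {α : Type*} [LinearOrder α] (s : Finset α) {k : ℕ}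
    (h : #s = k) (m : Fin k) : #{j ∈ s | j < s.orderEmbOfFin h m} = m := by
  have : {j ∈ s | j < s.orderEmbOfFin h m} = (Iio m).map (s.orderEmbOfFin h).toEmbedding := by
    ext j
    simp only [mem_filter, mem_map, mem_Iio, RelEmbedding.coe_toEmbedding]
    constructor
    · rintro ⟨hj, hlt⟩
      obtain ⟨n, rfl⟩ : j ∈ Set.range (s.orderEmbOfFin h) := by simpa using hj
      exact ⟨n, (s.orderEmbOfFin h).lt_iff_lt.mp hlt, rfl⟩
    · rintro ⟨n, hn, rfl⟩
      exact ⟨s.orderEmbOfFin_mem h n, (s.orderEmbOfFin h).lt_iff_lt.mpr hn⟩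
  rw [this, card_map, Fin.card_Iio]

theorem card_compl_filter_lt_orderEmbOfFin {l : ℕ} (I : Finset (Fin l)) {k : ℕ}
    (h : #I = k) (m : Fin k) :
    #{j ∈ univ \ I | j < I.orderEmbOfFin h m} = (I.orderEmbOfFin h m : ℕ) - m := by
  have hsum : #{j ∈ univ \ I | j < I.orderEmbOfFin h m} + #{j ∈ I | j < I.orderEmbOfFin h m} =
      (I.orderEmbOfFin h m : ℕ) := by
    rw [← card_union_of_disjoint (disjoint_filter_filter sdiff_disjoint), ← filter_union,
      sdiff_union_of_subset (subset_univ I), ← Fin.card_Iio]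
    congr 1
    ext j
    simp
  rw [card_filter_lt_orderEmbOfFin] at hsum
  omega

/-- The key polynomial identity (9.10): summing over all subsets
`I = {i₁ < … < i_k} ⊆ {1,…,ℓ}` the products `q̂^{(ℓ−k)(ℓ−k+1)/2}·∏_m (X_{i_m} − q̂^{i_m−m+1})`
recovers `X₁⋯X_ℓ` (indices 1-based; here subsets of `Fin ℓ` are 0-based, and the exponent
`i_m − m + 1` in 1-based indexing equals `(i_m) − (m) + 1` in 0-based indexing). -/
theorem telescoping_identity (R : Type*) [CommRing R] (qh : R) (l : ℕ) (X : Fin l → R) :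
    ∑ I ∈ (Finset.univ : Finset (Fin l)).powerset,
      qh ^ ((l - I.card) * (l - I.card + 1) / 2) *
        ∏ m : Fin I.card,
          (X (I.orderEmbOfFin rfl m) - qh ^ ((I.orderEmbOfFin rfl m : ℕ) - (m : ℕ) + 1))
    = ∏ i, X i := by
  rw [← sum_powerset_prod_sub_eq_prod (fun j => qh ^ (j + 1)) X univ]
  refine sum_congr rfl fun I _ => ?_
  rw [prod_range_pow_succ, card_sdiff_of_subset (subset_univ I), card_univ, Fintype.card_fin]
  congr 1
  rw [← prod_coe_sort I, ← (I.orderIsoOfFin rfl).toEquiv.prod_comp]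
  refine prod_congr rfl fun m _ => ?_
  rw [← card_compl_filter_lt_orderEmbOfFin I rfl m]
  rfl
end

section
/- Let q ∈ (0,1), s ∈ (−1,0), and let 1 ≤ ℓ ≤ n be integers. Let x₁ ≥ x₂ ≥ … ≥ x_ℓ ≥ 1 be integers, let σ : {1,…,ℓ} → {1,…,n} be injective with image J = σ({1,…,ℓ}), and let r₁ > r₂ > … > r_n be radii with |s| < r_n and r₁ < |s|^{−1}. Define Res_σ(u₁,…,u_n) = (1−q)^ℓ · q^{ℓ(ℓ−1)/2} · ∏_{i=1}^ℓ ((u_{σ(i)}−s)/(u_{σ(i)}−s^{−1}))^{x_i−1} · ∏_{α∈J, β∉J} (u_α−qu_β)/(u_α−u_β) · ∏_{1≤α<β≤ℓ} (u_{σ(α)}−qu_{σ(β)})/(u_{σ(α)}−u_{σ(β)}). Then for every λ ∈ Sign⁺_n: (2πi)^{−n} ∮_{|u₁|=r₁} ⋯ ∮_{|u_n|=r_n} ∏_{1≤α<β≤n} (u_α−u_β)/(u_α−qu_β) · Res_σ(u₁,…,u_n) · ∏_{i=1}^n [ 1/(u_i−s) · ((1−su_i)/(u_i−s))^{λ_i}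 ] du₁⋯du_n = 1_{{λ_{σ(i)} ≥ x_i − 1 for all i = 1,…,ℓ}} · (−s)^{|λ|} · q^{inv(σ)} · q^{σ(1)+…+σ(ℓ)} · q^{−ℓ} · (1−q)^ℓ, where inv(σ) = #{(i,j) : i < j, σ(i) > σ(j)} and all circles are positively oriented and centered at the origin. -/
open Finset

noncomputable section

/-- The residue `Res_σ(u₁,…,u_n)` of the q-moment integrand at `w_i = u_{σ(i)}⁻¹`. -/
def ResSig (q s : ℂ) {l n : ℕ} (x : Fin l → ℕ) (σ : Fin l → Fin n) (u : Fin n → ℂ) : ℂ :=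
  (1 - q) ^ l * q ^ (l * (l - 1) / 2) *
    (∏ i, ((u (σ i) - s) / (u (σ i) - s⁻¹)) ^ (x i - 1)) *
    (∏ a ∈ Finset.image σ Finset.univ, ∏ b ∈ (Finset.image σ Finset.univ)ᶜ,
      (u a - q * u b) / (u a - u b)) *
    ∏ p ∈ (Finset.univ : Finset (Fin l × Fin l)).filter (fun p => p.1 < p.2),
      (u (σ p.1) - q * u (σ p.2)) / (u (σ p.1) - u (σ p.2))

open MeasureTheory Filter Topology Metric Set in
/-- Fubini for torus integrals, with the `i`-th variable integrated first. -/
theorem torusIntegral_succAbove_inner {n : ℕ} {f : (Fin (n + 1) → ℂ) → ℂ} {c : Fin (n + 1) → ℂ}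
    {R : Fin (n + 1) → ℝ} (hf : TorusIntegrable f c R) (i : Fin (n + 1)) :
    torusIntegral f c R =
      torusIntegral (fun y => ∮ x in C(c i, R i), f (i.insertNth x y))
        (c ∘ i.succAbove) (R ∘ i.succAbove) := by
  set e : ℝ × (Fin n → ℝ) ≃ᵐ (Fin (n + 1) → ℝ) :=
    (MeasurableEquiv.piFinSuccAbove (fun _ => ℝ) i).symm
  have hem : MeasurePreserving e :=
    (volume_preserving_piFinSuccAbove (fun _ : Fin (n + 1) => ℝ) i).symm _
  have heπ : (e ⁻¹' Icc 0 fun _ => 2 * Real.pi) =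
      Icc 0 (2 * Real.pi) ×ˢ Icc (0 : Fin n → ℝ) fun _ => 2 * Real.pi :=
    ((Fin.insertNthOrderIso (fun _ => ℝ) i).preimage_Icc _ _).trans (Icc_prod_eq _ _)
  rw [torusIntegral, ← hem.map_eq, setIntegral_map_equiv, heπ, Measure.volume_eq_prod,
    ← Measure.prod_restrict, integral_prod_symm, torusIntegral]
  · refine setIntegral_congr_fun measurableSet_Icc fun Θ _ => ?_
    simp +unfoldPartialApp only [e, circleIntegral_def_Icc, ← integral_smul,
      deriv_circleMap, i.prod_univ_succAbove _, smul_smul, torusMap, circleMap_zero]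
    refine setIntegral_congr_fun measurableSet_Icc fun θ _ => ?_
    simp only [MeasurableEquiv.piFinSuccAbove_symm_apply, i.insertNth_apply_same,
      i.insertNth_apply_succAbove, (· ∘ ·), Fin.insertNthEquiv, Equiv.coe_fn_mk]
    rw [mul_comm]
    congr 2
    simp only [funext_iff, i.forall_iff_succAbove, circleMap, Fin.insertNth_apply_same,
      Fin.insertNth_apply_succAbove, imp_true_iff, and_self_iff]
  · have := hf.function_integrable
    rw [← hem.integrableOn_comp_preimage e.measurableEmbedding, heπ, Measure.volume_eq_prod,
      IntegrableOn, ← Measure.prod_restrict] at this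
    exact this

theorem torusMap_zero_mem {n : ℕ} {R : Fin n → ℝ} (hR : ∀ i, 0 < R i) (θ : Fin n → ℝ) :
    torusMap 0 R θ ∈ Set.pi Set.univ (fun i => Metric.sphere (0 : ℂ) (R i)) := by
  intro i _
  simp [torusMap, abs_of_pos (hR i)]

theorem torusIntegrable_of_continuousOn {n : ℕ} {f : (Fin n → ℂ) → ℂ} {R : Fin n → ℝ}
    (hR : ∀ i, 0 < R i)
    (hf : ContinuousOn f (Set.pi Set.univ (fun i => Metric.sphere (0 : ℂ) (R i)))) :
    TorusIntegrable f 0 R := by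
  have hc : Continuous fun θ => f (torusMap 0 R θ) := by
    refine hf.comp_continuous ?_ (torusMap_zero_mem hR)
    unfold torusMap
    fun_prop
  exact hc.continuousOn.integrableOn_compact isCompact_Icc

theorem torusIntegral_congr {n : ℕ} {f g : (Fin n → ℂ) → ℂ} {R : Fin n → ℝ} (hR : ∀ i, 0 < R i)
    (h : Set.EqOn f g (Set.pi Set.univ (fun i => Metric.sphere (0 : ℂ) (R i)))) :
    torusIntegral f 0 R = torusIntegral g 0 R := by
  unfold torusIntegral
  simp only [h (torusMap_zero_mem hR _)]

theorem iterInt_circle_eq_torusIntegral {n : ℕ} {f : (Fin n → ℂ) → ℂ} {R : Fin n → ℝ}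
    (hR : ∀ i, 0 < R i)
    (hf : ContinuousOn f (Set.pi Set.univ (fun i => Metric.sphere (0 : ℂ) (R i)))) :
    iterInt n (fun i => fun g => ∮ z in C(0, R i), g z) f = torusIntegral f 0 R := by
  induction n with
  | zero =>
    rw [torusIntegral_dim0]
    exact congrArg f (Subsingleton.elim _ _)
  | succ n ih =>
    rw [torusIntegral_succ (torusIntegrable_of_continuousOn hR hf)]
    change (∮ z in C(0, R 0), iterInt n (fun i => fun g => ∮ z in C(0, R i.succ), g z)
      (fun u => f (Fin.cons z u))) =
      ∮ z in C(0, R 0), torusIntegral (fun u => f (Fin.cons z u)) 0 (fun i => R i.succ)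
    refine circleIntegral.integral_congr (hR 0).le fun z hz => ?_
    refine ih (fun i => hR i.succ) (hf.comp (by fun_prop) fun u hu i _ => ?_)
    refine Fin.cases ?_ (fun j => ?_) i
    · simpa using hz
    · simpa using hu j (Set.mem_univ _)

open Filter Topology Bornology in
/-- Evaluation of a contour integral by the residue at infinity. -/
theorem circleIntegral_eq_of_tendsto_cobounded {g : ℂ → ℂ} {R : ℝ} {L : ℂ} (hR : 0 < R)
    (hd : ∀ z, R ≤ ‖z‖ → DifferentiableAt ℂ g z)
    (hL : Tendsto (fun z => z * g z) (cobounded ℂ) (𝓝 L)) :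
    (∮ z in C(0, R), g z) = 2 * Real.pi * Complex.I * L := by
  set D := (∮ z in C(0, R), g z) - 2 * Real.pi * Complex.I * L
  have key : ∀ ε > 0, ‖D‖ ≤ 2 * Real.pi * ε := by
    intro ε hε
    have h1 : ∀ᶠ z in cobounded ℂ, ‖z * g z - L‖ < ε := by
      simpa [dist_eq_norm] using hL.eventually (Metric.ball_mem_nhds L hε)
    rw [← comap_norm_atTop, eventually_comap] at h1
    obtain ⟨R', hR'⟩ := (h1.and (eventually_ge_atTop R)).exists
    obtain ⟨h2, hle⟩ := hR'
    have hpos : 0 < R' := hR.trans_le hle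
    have h3 : (∮ z in C(0, R), g z) = ∮ z in C(0, R'), g z := by
      refine (Complex.circleIntegral_eq_of_differentiable_on_annulus_off_countable hR hle
        Set.countable_empty (fun z hz => ?_) fun z hz => ?_).symm
      · exact (hd z (by simpa using hz.2)).continuousAt.continuousWithinAt
      · exact hd z (by simpa using (not_le.1 (fun h => hz.1.2 (by simpa using h))).le)
    have hsph : ∀ z ∈ Metric.sphere (0 : ℂ) R', ‖z‖ = R' := fun z hz => by simpa using hz
    have h4 : D = ∮ z in C(0, R'), (g z - L * (z - 0)⁻¹) := by
      rw [circleIntegral.integral_sub, circleIntegral.integral_const_mul,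
        circleIntegral.integral_sub_center_inv _ hpos.ne', ← h3, mul_comm L]
      · exact ContinuousOn.circleIntegrable hpos.le fun z hz =>
          (hd z (by rw [hsph z hz]; exact hle)).continuousAt.continuousWithinAt
      · refine ContinuousOn.circleIntegrable hpos.le (continuousOn_const.mul
          (ContinuousOn.inv₀ (by fun_prop) fun z hz h => ?_))
        have := hsph z hz
        rw [sub_zero] at h
        rw [h, norm_zero] at this
        exact hpos.ne this
    rw [h4]
    refine (circleIntegral.norm_integral_le_of_norm_le_const (C := ε / R') hpos.le
      fun z hz => ?_).trans (le_of_eq (by field_simp))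
    have hz' := hsph z hz
    have hz0 : z ≠ 0 := norm_ne_zero_iff.1 (by rw [hz']; exact hpos.ne')
    have : g z - L * (z - 0)⁻¹ = (z * g z - L) / z := by
      rw [sub_zero]; field_simp
    rw [this, norm_div, hz']
    gcongr
    exact (h2 z hz').le
  have hD : ‖D‖ ≤ 0 := by
    refine le_of_forall_pos_le_add fun ε hε => ?_
    have := key (ε / (2 * Real.pi)) (by positivity)
    rw [zero_add]
    refine this.trans (le_of_eq ?_)
    field_simp
  exact sub_eq_zero.1 (norm_le_zero_iff.1 hD)

/-- The product of a pair kernel over all ordered pairs `i < j` and of one-variable weights. -/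
def nestedProd {n : ℕ} (K : Fin n → Fin n → ℂ → ℂ → ℂ) (f : Fin n → ℂ → ℂ) (u : Fin n → ℂ) : ℂ :=
  (∏ i, ∏ j, if i < j then K i j (u i) (u j) else 1) * ∏ i, f i (u i)

theorem nestedProd_cons {n : ℕ} (K : Fin (n + 1) → Fin (n + 1) → ℂ → ℂ → ℂ)
    (f : Fin (n + 1) → ℂ → ℂ) (x : ℂ) (y : Fin n → ℂ) :
    nestedProd K f (Fin.cons x y) =
      nestedProd (fun i j => K i.succ j.succ) (fun i => f i.succ) y *
        (f 0 x * ∏ j : Fin n, K 0 j.succ x (y j)) := by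
  simp only [nestedProd, Fin.prod_univ_succ, Fin.cons_zero, Fin.cons_succ, if_false,
    Fin.succ_pos, if_true, Fin.not_lt_zero, Fin.succ_lt_succ_iff, one_mul]
  ring

theorem continuousOn_nestedProd {n : ℕ} {K : Fin n → Fin n → ℂ → ℂ → ℂ} {f : Fin n → ℂ → ℂ}
    {R : Fin n → ℝ} (hanti : StrictAnti R)
    (hK : ∀ i j, ∀ p : ℂ × ℂ, ‖p.2‖ < ‖p.1‖ →
      DifferentiableAt ℂ (fun p : ℂ × ℂ => K i j p.1 p.2) p)
    (hf : ∀ i, ContinuousOn (f i) (Metric.sphere 0 (R i))) :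
    ContinuousOn (nestedProd K f) (Set.pi Set.univ (fun i => Metric.sphere (0 : ℂ) (R i))) := by
  refine ContinuousOn.mul (continuousOn_finsetProd _ fun i _ => continuousOn_finsetProd _
    fun j _ => ?_) (continuousOn_finsetProd _ fun i _ => ?_)
  · split_ifs with hij
    · intro u hu
      have hi : ‖u i‖ = R i := by simpa using hu i (Set.mem_univ _)
      have hj : ‖u j‖ = R j := by simpa using hu j (Set.mem_univ _)
      have h := (hK i j (u i, u j) (by rw [hi, hj]; exact hanti hij)).continuousAt
      exact (ContinuousAt.comp (f := fun u : Fin n → ℂ => (u i, u j)) h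
        (by fun_prop)).continuousWithinAt
    · exact continuousOn_const
  · exact (hf i).comp (by fun_prop) fun u hu => hu i (Set.mem_univ _)

open Filter Topology Bornology in
/-- If all weights are regular outside their circles, the nested contour integral factorizes into
the contributions of the residues at infinity. -/
theorem torusIntegral_nestedProd {n : ℕ} {K : Fin n → Fin n → ℂ → ℂ → ℂ} {a : Fin n → Fin n → ℂ}
    {f : Fin n → ℂ → ℂ} {L : Fin n → ℂ} {R : Fin n → ℝ} (hR : ∀ i, 0 < R i)
    (hanti : StrictAnti R)
    (hK : ∀ i j, ∀ p : ℂ × ℂ, ‖p.2‖ < ‖p.1‖ →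
      DifferentiableAt ℂ (fun p : ℂ × ℂ => K i j p.1 p.2) p)
    (ha : ∀ i j y, Tendsto (fun x => K i j x y) (cobounded ℂ) (𝓝 (a i j)))
    (hf : ∀ i z, R i ≤ ‖z‖ → DifferentiableAt ℂ (f i) z)
    (hL : ∀ i, Tendsto (fun z => z * f i z) (cobounded ℂ) (𝓝 (L i))) :
    torusIntegral (nestedProd K f) 0 R =
      (2 * Real.pi * Complex.I) ^ n * ((∏ i, ∏ j, if i < j then a i j else 1) * ∏ i, L i) := by
  induction n with
  | zero => simp [nestedProd]
  | succ n ih =>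
    have hcont := continuousOn_nestedProd hanti hK fun i z hz =>
      (hf i z (mem_sphere_zero_iff_norm.1 hz).ge).continuousAt.continuousWithinAt
    rw [torusIntegral_succAbove_inner (torusIntegrable_of_continuousOn hR hcont) 0]
    have hcongr : Set.EqOn (fun y : Fin n → ℂ => ∮ x in C((0 : Fin (n + 1) → ℂ) 0, R 0),
          nestedProd K f (Fin.insertNth 0 x y))
        (fun y => (2 * Real.pi * Complex.I * (L 0 * ∏ j : Fin n, a 0 j.succ)) *
          nestedProd (fun i j => K i.succ j.succ) (fun i => f i.succ) y)
        (Set.pi Set.univ (fun i : Fin n => Metric.sphere (0 : ℂ) (R i.succ))) := by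
      intro y hy
      simp only [Fin.insertNth_zero', nestedProd_cons, Pi.zero_apply]
      rw [circleIntegral.integral_const_mul, mul_comm]
      congr 1
      refine circleIntegral_eq_of_tendsto_cobounded (hR 0) (fun z hz => ?_) ?_
      · refine (hf 0 z hz).mul (DifferentiableAt.fun_finsetProd fun j _ => ?_)
        have hj : ‖y j‖ = R j.succ := by simpa using hy j (Set.mem_univ _)
        exact DifferentiableAt.comp (f := fun x : ℂ => (x, y j)) z
          (hK 0 j.succ (z, y j) (by
            rw [hj]; exact (hanti (Fin.succ_pos j)).trans_le hz)) (by fun_prop)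
      · simp only [← mul_assoc]
        exact (hL 0).mul (tendsto_finsetProd _ fun j _ => ha 0 j.succ (y j))
    refine (torusIntegral_congr (fun i => hR i.succ) hcongr).trans ?_
    rw [torusIntegral_const_mul, ih (fun i => hR i.succ) (fun i j h => hanti (by simpa using h))
      (fun i j => hK i.succ j.succ) (fun i j => ha i.succ j.succ) (fun i => hf i.succ)
      (fun i => hL i.succ)]
    simp only [Fin.prod_univ_succ, if_false,
      Fin.succ_pos, if_true, Fin.not_lt_zero, Fin.succ_lt_succ_iff, one_mul, pow_succ]
    ring

/-- If the weight of the variable `k` is regular inside its circle and `k` does not interact with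
the variables after it, the nested contour integral vanishes. -/
theorem torusIntegral_nestedProd_eq_zero {n : ℕ} {K : Fin n → Fin n → ℂ → ℂ → ℂ}
    {f : Fin n → ℂ → ℂ} {R : Fin n → ℝ} (hR : ∀ i, 0 < R i) (hanti : StrictAnti R)
    (hK : ∀ i j, ∀ p : ℂ × ℂ, ‖p.2‖ < ‖p.1‖ →
      DifferentiableAt ℂ (fun p : ℂ × ℂ => K i j p.1 p.2) p)
    (hf : ∀ i, ContinuousOn (f i) (Metric.sphere 0 (R i)))
    (k : Fin n) (hk : ∀ j, k < j → K k j = fun _ _ => 1)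
    (hfk : ∀ z, ‖z‖ ≤ R k → DifferentiableAt ℂ (f k) z) :
    torusIntegral (nestedProd K f) 0 R = 0 := by
  obtain _ | n := n
  · exact k.elim0
  rw [torusIntegral_succAbove_inner
    (torusIntegrable_of_continuousOn hR (continuousOn_nestedProd hanti hK hf)) k]
  refine (torusIntegral_congr (g := fun _ => 0) (fun i => hR (k.succAbove i))
    fun y hy => ?_).trans (by simp [torusIntegral])
  have hd : ∀ z, ‖z‖ ≤ R k →
      DifferentiableAt ℂ (fun x => nestedProd K f (k.insertNth x y)) z := by
    intro z hz
    refine DifferentiableAt.mul (DifferentiableAt.fun_finsetProd fun i _ =>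
      DifferentiableAt.fun_finsetProd fun j _ => ?_)
      (DifferentiableAt.fun_finsetProd fun i _ => ?_)
    · split_ifs with hij
      · obtain rfl | ⟨i, rfl⟩ := Fin.eq_self_or_eq_succAbove k i
        · simp [hk j hij]
        · obtain rfl | ⟨j, rfl⟩ := Fin.eq_self_or_eq_succAbove k j
          · simp only [Fin.insertNth_apply_same, Fin.insertNth_apply_succAbove]
            have hi : ‖y i‖ = R (j.succAbove i) := by simpa using hy i (Set.mem_univ _)
            exact DifferentiableAt.comp (f := fun x : ℂ => (y i, x)) z
              (hK _ _ (y i, z) (by rw [hi]; exact hz.trans_lt (hanti hij))) (by fun_prop)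
          · simp
      · simp
    · obtain rfl | ⟨i, rfl⟩ := Fin.eq_self_or_eq_succAbove k i
      · simpa using hfk z hz
      · simp
  exact Complex.circleIntegral_eq_zero_of_differentiable_on_off_countable (hR k).le
    Set.countable_empty
    (fun z hz => (hd z (by simpa using hz)).continuousAt.continuousWithinAt)
    fun z hz => hd z (by simpa using (Metric.ball_subset_closedBall hz.1))

open Filter Topology Bornology in
theorem tendsto_moebius_cobounded (a b c : ℂ) :
    Tendsto (fun z => (a * z - b) / (z - c)) (cobounded ℂ) (𝓝 a) := by
  have h1 : Tendsto (fun z : ℂ => (z - c)⁻¹) (cobounded ℂ) (𝓝 0) := by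
    refine tendsto_inv₀_cobounded.comp ?_
    simp [sub_eq_add_neg]
  have h2 : Tendsto (fun z : ℂ => a + (a * c - b) * (z - c)⁻¹) (cobounded ℂ) (𝓝 a) := by
    simpa using (h1.const_mul (a * c - b)).const_add a
  refine h2.congr' ?_
  filter_upwards [eventually_ne_cobounded c] with z hz
  have : z - c ≠ 0 := sub_ne_zero.2 hz
  field_simp
  ring

/-- The pair kernel attached to a rank function: the factor `(x - y) / (x - q y)` times the
factors `(x - q y) / (x - y)` of the pairs of increasing rank. -/
def rankKernel {n : ℕ} (q : ℂ) (ρ : Fin n → ℕ) (i j : Fin n) : ℂ → ℂ → ℂ :=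
  if ρ i < ρ j then fun _ _ => 1
  else fun x y => ((if ρ j < ρ i then q else 1) * x - y) / (x - q * y)

theorem differentiableAt_rankKernel {n : ℕ} {q : ℂ} (hq : ‖q‖ ≤ 1) (ρ : Fin n → ℕ) (i j : Fin n)
    (p : ℂ × ℂ) (hp : ‖p.2‖ < ‖p.1‖) :
    DifferentiableAt ℂ (fun p : ℂ × ℂ => rankKernel q ρ i j p.1 p.2) p := by
  unfold rankKernel
  by_cases h : ρ i < ρ j
  · simp [h]
  · simp only [h, if_false]
    have hne : p.1 - q * p.2 ≠ 0 := sub_ne_zero.2 fun h0 => hp.not_ge <| by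
      rw [h0, norm_mul]
      exact mul_le_of_le_one_left (norm_nonneg _) hq
    fun_prop (disch := assumption)

open Filter Topology Bornology in
theorem tendsto_rankKernel {n : ℕ} (q : ℂ) (ρ : Fin n → ℕ) (i j : Fin n) (y : ℂ) :
    Tendsto (fun x => rankKernel q ρ i j x y) (cobounded ℂ)
      (𝓝 (if ρ j < ρ i then q else 1)) := by
  unfold rankKernel
  by_cases h : ρ i < ρ j
  · simp [h, h.le]
  · simp only [h, if_false]
    exact tendsto_moebius_cobounded _ _ _

/-- The one-variable weight `((z-s)/(z-s⁻¹))^e · (z-s)⁻¹ · ((1-sz)/(z-s))^m` after cancellation. -/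
def reducedWeight (s : ℂ) (e m : ℕ) (z : ℂ) : ℂ :=
  if e ≤ m then (-s) ^ e * (1 / (z - s) * ((1 - s * z) / (z - s)) ^ (m - e))
  else (-s) ^ m * ((z - s) ^ (e - m - 1) / (z - s⁻¹) ^ (e - m))

theorem reducedWeight_eq {s z : ℂ} (hs : s ≠ 0) (hz : z ≠ s) (hz' : z ≠ s⁻¹) (e m : ℕ) :
    ((z - s) / (z - s⁻¹)) ^ e * (1 / (z - s) * ((1 - s * z) / (z - s)) ^ m) =
      reducedWeight s e m z := by
  have h1 : z - s ≠ 0 := sub_ne_zero.2 hz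
  have h2 : z - s⁻¹ ≠ 0 := sub_ne_zero.2 hz'
  have h3 : (z - s) / (z - s⁻¹) * ((1 - s * z) / (z - s)) = -s := by
    have : 1 - s * z = -s * (z - s⁻¹) := by field_simp; ring
    rw [this]
    generalize z - s = a at *
    generalize z - s⁻¹ = b at *
    field_simp
  unfold reducedWeight
  split_ifs with h
  · obtain ⟨d, rfl⟩ := Nat.exists_eq_add_of_le h
    rw [Nat.add_sub_cancel_left, ← h3, mul_pow, pow_add]
    ring
  · obtain ⟨d, rfl⟩ := Nat.exists_eq_add_of_lt (not_le.1 h)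
    rw [show m + d + 1 - m = d + 1 by omega, Nat.add_sub_cancel, ← h3, mul_pow, add_assoc, pow_add,
      div_pow _ _ (d + 1), pow_succ (z - s) d]
    field_simp

theorem differentiableAt_reducedWeight_of_le {s z : ℂ} {e m : ℕ} (h : e ≤ m) (hz : z ≠ s) :
    DifferentiableAt ℂ (reducedWeight s e m) z := by
  have h1 : z - s ≠ 0 := sub_ne_zero.2 hz
  unfold reducedWeight
  simp only [h, if_true]
  fun_prop (disch := assumption)

theorem differentiableAt_reducedWeight_of_lt {s z : ℂ} {e m : ℕ} (h : m < e) (hz : z ≠ s⁻¹) :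
    DifferentiableAt ℂ (reducedWeight s e m) z := by
  have h1 : (z - s⁻¹) ^ (e - m) ≠ 0 := pow_ne_zero _ (sub_ne_zero.2 hz)
  unfold reducedWeight
  simp only [h.not_ge, if_false]
  fun_prop (disch := assumption)

open Filter Topology Bornology in
theorem tendsto_mul_reducedWeight {s : ℂ} {e m : ℕ} (h : e ≤ m) :
    Tendsto (fun z => z * reducedWeight s e m z) (cobounded ℂ) (𝓝 ((-s) ^ m)) := by
  have h1 := (tendsto_moebius_cobounded 1 0 s).mul
    ((tendsto_moebius_cobounded (-s) (-1) s).pow (m - e))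
  have h2 := h1.const_mul ((-s) ^ e)
  rw [one_mul, ← pow_add, Nat.add_sub_cancel' h] at h2
  refine h2.congr fun z => ?_
  rw [reducedWeight, if_pos h, show -s * z - -1 = 1 - s * z by ring]
  ring

/-- The position of `j` in the list `σ`, or `l` when `j` is not in the range of `σ`. -/
def injRank {l n : ℕ} (σ : Fin l → Fin n) : Fin n → ℕ :=
  Function.extend σ (fun i => (i : ℕ)) fun _ => l

theorem injRank_apply {l n : ℕ} {σ : Fin l → Fin n} (hσ : Function.Injective σ) (i : Fin l) :
    injRank σ (σ i) = i := hσ.extend_apply _ _ _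

theorem injRank_of_notMem {l n : ℕ} {σ : Fin l → Fin n} {j : Fin n}
    (hj : j ∉ Finset.image σ Finset.univ) : injRank σ j = l :=
  Function.extend_apply' _ _ _ (by simpa using hj)

theorem prod_eq_prod_image_mul_compl {M : Type*} [CommMonoid M] {l n : ℕ} {σ : Fin l → Fin n}
    (hσ : Function.Injective σ) (f : Fin n → M) :
    ∏ j, f j = (∏ i, f (σ i)) * ∏ j ∈ (Finset.image σ Finset.univ)ᶜ, f j := by
  rw [← Finset.prod_mul_prod_compl (Finset.image σ Finset.univ) f,
    Finset.prod_image fun _ _ _ _ h => hσ h]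

theorem prod_injRank_lt {M : Type*} [CommMonoid M] {l n : ℕ} {σ : Fin l → Fin n}
    (hσ : Function.Injective σ) (g : Fin n → Fin n → M) :
    (∏ i, ∏ j, if injRank σ i < injRank σ j then g i j else 1) =
      (∏ a ∈ Finset.image σ Finset.univ, ∏ b ∈ (Finset.image σ Finset.univ)ᶜ, g a b) *
        ∏ p ∈ (Finset.univ : Finset (Fin l × Fin l)).filter (fun p => p.1 < p.2),
          g (σ p.1) (σ p.2) := by
  have h1 : ∀ a : Fin l, (∏ j, if injRank σ (σ a) < injRank σ j then g (σ a) j else 1) =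
      (∏ b, if a < b then g (σ a) (σ b) else 1) *
        ∏ b ∈ (Finset.image σ Finset.univ)ᶜ, g (σ a) b := by
    intro a
    rw [prod_eq_prod_image_mul_compl hσ]
    simp only [injRank_apply hσ, Fin.val_fin_lt]
    congr 1
    refine Finset.prod_congr rfl fun b hb => ?_
    rw [injRank_of_notMem (Finset.mem_compl.1 hb), if_pos a.2]
  have h2 : ∀ a ∈ (Finset.image σ Finset.univ)ᶜ,
      (∏ j, if injRank σ a < injRank σ j then g a j else 1) = 1 := by
    intro a ha
    refine Finset.prod_eq_one fun j _ => if_neg ?_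
    rw [injRank_of_notMem (Finset.mem_compl.1 ha), not_lt]
    by_cases hj : j ∈ Finset.image σ Finset.univ
    · obtain ⟨b, -, rfl⟩ := Finset.mem_image.1 hj
      rw [injRank_apply hσ]
      exact b.2.le
    · rw [injRank_of_notMem hj]
  rw [prod_eq_prod_image_mul_compl hσ, Finset.prod_eq_one h2, mul_one,
    Finset.prod_congr rfl fun a _ => h1 a, Finset.prod_mul_distrib, mul_comm,
    Finset.prod_image fun _ _ _ _ h => hσ h, Finset.prod_filter, Fintype.prod_prod_type]

theorem prod_prod_eq_prod_lt_mul_swap {M : Type*} [CommMonoid M] {n : ℕ} (g : Fin n → Fin n → M)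
    (hg : ∀ i, g i i = 1) :
    ∏ i, ∏ j, g i j = ∏ i, ∏ j, if i < j then g i j * g j i else 1 := by
  have h : ∀ i j, g i j = (if i < j then g i j else 1) * if j < i then g i j else 1 := by
    intro i j
    rcases lt_trichotomy i j with h | rfl | h
    · simp [h, h.not_gt]
    · simp [hg]
    · simp [h, h.not_gt]
  have h' : ∀ i j, (if i < j then g i j * g j i else 1) =
      (if i < j then g i j else 1) * if i < j then g j i else 1 := by
    intro i j
    split_ifs <;> simp
  calc ∏ i, ∏ j, g i j
      = ∏ i, ∏ j, ((if i < j then g i j else 1) * if j < i then g i j else 1) :=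
        Finset.prod_congr rfl fun i _ => Finset.prod_congr rfl fun j _ => h i j
    _ = (∏ i, ∏ j, if i < j then g i j else 1) * ∏ i, ∏ j, if i < j then g j i else 1 := by
        simp only [Finset.prod_mul_distrib]
        congr 1
        exact Finset.prod_comm
    _ = ∏ i, ∏ j, if i < j then g i j * g j i else 1 := by
        simp only [h', Finset.prod_mul_distrib]

theorem prod_ite_lt_eq_pow {M : Type*} [CommMonoid M] {n : ℕ} (q : M) (b : Fin n) :
    (∏ a, if a < b then q else 1) = q ^ (b : ℕ) := by
  rw [← Finset.prod_filter, Finset.prod_const,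
    show Finset.univ.filter (fun a => a < b) = Finset.Iio b by ext; simp, Fin.card_Iio]

theorem prod_injRank_inversions {M : Type*} [CommMonoid M] {l n : ℕ} {σ : Fin l → Fin n}
    (hσ : Function.Injective σ) (q : M) :
    q ^ (l * (l - 1) / 2) *
        (∏ i, ∏ j, if i < j then (if injRank σ j < injRank σ i then q else 1) else 1) =
      q ^ (((Finset.univ : Finset (Fin l × Fin l)).filter
          (fun p => p.1 < p.2 ∧ σ p.2 < σ p.1)).card) * q ^ (∑ i, (σ i : ℕ)) := by
  set I := ∏ b : Fin l, ∏ a : Fin l, if a < b then (if σ b < σ a then q else 1) else 1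
  set N := ∏ b : Fin l, ∏ a : Fin l, if a < b then (if σ a < σ b then q else 1) else 1
  set A := ∏ i, ∏ j, if i < j then (if injRank σ j < injRank σ i then q else 1) else 1
  have hI : q ^ (((Finset.univ : Finset (Fin l × Fin l)).filter
      (fun p => p.1 < p.2 ∧ σ p.2 < σ p.1)).card) = I := by
    rw [← Finset.prod_const, Finset.prod_filter, Fintype.prod_prod_type, Finset.prod_comm]
    simp only [ite_and, I]
  have hNI : N * I = q ^ (l * (l - 1) / 2) := by
    rw [← Finset.sum_range_id, ← Fin.sum_univ_eq_sum_range (fun i => i),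
      ← Finset.prod_pow_eq_pow_sum]
    simp only [N, I, ← Finset.prod_mul_distrib, ← prod_ite_lt_eq_pow q]
    refine Finset.prod_congr rfl fun b _ => Finset.prod_congr rfl fun a _ => ?_
    split_ifs with h1 h2 h3 h3
    · exact absurd h2 h3.not_gt
    · simp
    · simp
    · exact absurd (hσ (le_antisymm (not_lt.1 h3) (not_lt.1 h2))) h1.ne
    · simp
  have hAN : A * N = q ^ (∑ i, (σ i : ℕ)) := by
    have hA : A = ∏ b : Fin l, ∏ i, if i < σ b then (if (b : ℕ) < injRank σ i then q else 1)
        else 1 := by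
      simp only [A]
      rw [Finset.prod_comm, prod_eq_prod_image_mul_compl hσ]
      simp only [injRank_apply hσ]
      rw [Finset.prod_eq_one (s := (Finset.image σ Finset.univ)ᶜ), mul_one]
      intro j hj
      refine Finset.prod_eq_one fun i _ => ?_
      rw [injRank_of_notMem (Finset.mem_compl.1 hj)]
      have : ¬ l < injRank σ i := by
        rw [not_lt]
        by_cases hi : i ∈ Finset.image σ Finset.univ
        · obtain ⟨b, -, rfl⟩ := Finset.mem_image.1 hi
          rw [injRank_apply hσ]
          exact b.2.le
        · rw [injRank_of_notMem hi]
      simp [this]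
    have hN : N = ∏ b : Fin l, ∏ i, if i < σ b then (if injRank σ i < b then q else 1)
        else 1 := by
      refine Finset.prod_congr rfl fun b _ => ?_
      rw [prod_eq_prod_image_mul_compl hσ,
        Finset.prod_eq_one (s := (Finset.image σ Finset.univ)ᶜ), mul_one]
      · simp only [injRank_apply hσ, Fin.val_fin_lt]
        refine Finset.prod_congr rfl fun a _ => ?_
        split_ifs <;> rfl
      · intro j hj
        rw [injRank_of_notMem (Finset.mem_compl.1 hj)]
        simp [b.2.le]
    rw [hA, hN, ← Finset.prod_pow_eq_pow_sum]
    simp only [← Finset.prod_mul_distrib, ← prod_ite_lt_eq_pow q]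
    refine Finset.prod_congr rfl fun b _ => Finset.prod_congr rfl fun i _ => ?_
    by_cases h : i < σ b
    · have hne : injRank σ i ≠ b := by
        by_cases hi : i ∈ Finset.image σ Finset.univ
        · obtain ⟨a, -, rfl⟩ := Finset.mem_image.1 hi
          rw [injRank_apply hσ]
          intro hab
          rw [Fin.ext hab] at h
          exact lt_irrefl _ h
        · rw [injRank_of_notMem hi]
          exact b.2.ne'
      rcases hne.lt_or_gt with h' | h'
      · simp [h, h', h'.not_gt]
      · simp [h, h', h'.not_gt]
    · simp [h]
  rw [hI, ← hAN, ← hNI]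
  ac_rfl

/-- On tuples of distinct points off the poles, the integrand equals a nested product in which the
factors common to the kernel and the residue are cancelled. -/
theorem integrand_eq_nestedProd {q s : ℂ} (hs : s ≠ 0) {l n : ℕ} {x : Fin l → ℕ}
    {σ : Fin l → Fin n} (hσ : Function.Injective σ) {m : Fin n → ℕ} {u : Fin n → ℂ}
    (hu : ∀ i j, i ≠ j → u i ≠ u j) (huq : ∀ i j, i < j → u i ≠ q * u j)
    (hus : ∀ i, u i ≠ s) (hus' : ∀ i, u i ≠ s⁻¹) :
    (∏ p ∈ (Finset.univ : Finset (Fin n × Fin n)).filter (fun p => p.1 < p.2),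
        (u p.1 - u p.2) / (u p.1 - q * u p.2)) * ResSig q s x σ u *
        ∏ i, (1 / (u i - s) * ((1 - s * u i) / (u i - s)) ^ m i) =
      (1 - q) ^ l * q ^ (l * (l - 1) / 2) *
        nestedProd (rankKernel q (injRank σ)) (fun j =>
          reducedWeight s (Function.extend σ (fun i => x i - 1) (0 : Fin n → ℕ) j) (m j)) u := by
  have hpair : (∏ p ∈ (Finset.univ : Finset (Fin n × Fin n)).filter (fun p => p.1 < p.2),
        (u p.1 - u p.2) / (u p.1 - q * u p.2)) *
      ((∏ a ∈ Finset.image σ Finset.univ, ∏ b ∈ (Finset.image σ Finset.univ)ᶜ,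
        (u a - q * u b) / (u a - u b)) *
        ∏ p ∈ (Finset.univ : Finset (Fin l × Fin l)).filter (fun p => p.1 < p.2),
          (u (σ p.1) - q * u (σ p.2)) / (u (σ p.1) - u (σ p.2))) =
      ∏ i, ∏ j, if i < j then rankKernel q (injRank σ) i j (u i) (u j) else 1 := by
    rw [← prod_injRank_lt hσ fun a b => (u a - q * u b) / (u a - u b),
      prod_prod_eq_prod_lt_mul_swap _ fun i => if_neg (lt_irrefl _), Finset.prod_filter,
      Fintype.prod_prod_type]
    simp only [← Finset.prod_mul_distrib]
    refine Finset.prod_congr rfl fun i _ => Finset.prod_congr rfl fun j _ => ?_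
    by_cases hij : i < j
    · have h1 : u i - u j ≠ 0 := sub_ne_zero.2 (hu i j hij.ne)
      have h2 : u j - u i ≠ 0 := sub_ne_zero.2 (hu j i hij.ne')
      have h3 : u i - q * u j ≠ 0 := sub_ne_zero.2 (huq i j hij)
      simp only [hij, if_true, rankKernel]
      rcases lt_trichotomy (injRank σ i) (injRank σ j) with h | h | h
      · simp only [h, h.not_gt, if_true, if_false, mul_one]
        rw [div_mul_div_comm, mul_comm, div_self (mul_ne_zero h3 h1)]
      · simp [h]
      · simp only [h, h.not_gt, if_true, if_false]
        rw [← neg_sub (u j) (u i)]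
        field_simp
        ring
    · simp [hij]
  have hweight : (∏ i, ((u (σ i) - s) / (u (σ i) - s⁻¹)) ^ (x i - 1)) *
      ∏ i, (1 / (u i - s) * ((1 - s * u i) / (u i - s)) ^ m i) =
      ∏ j, reducedWeight s (Function.extend σ (fun i => x i - 1) (0 : Fin n → ℕ) j) (m j)
        (u j) := by
    have h : (∏ i, ((u (σ i) - s) / (u (σ i) - s⁻¹)) ^ (x i - 1)) =
        ∏ j, ((u j - s) / (u j - s⁻¹)) ^
          Function.extend σ (fun i => x i - 1) (0 : Fin n → ℕ) j := by
      rw [prod_eq_prod_image_mul_compl hσ,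
        Finset.prod_eq_one (s := (Finset.image σ Finset.univ)ᶜ), mul_one]
      · simp only [hσ.extend_apply]
      · intro j hj
        rw [Function.extend_apply' _ _ _ (by simpa using hj), Pi.zero_apply, pow_zero]
    rw [h, ← Finset.prod_mul_distrib]
    exact Finset.prod_congr rfl fun j _ => reducedWeight_eq hs (hus j) (hus' j) _ _
  rw [nestedProd, ← hpair, ← hweight, ResSig]
  ring

/-- Lemma 9.12: evaluation of the nested contour integral of `Res_σ` against the spatial
biorthogonality kernel, with the q-nested contours realized as concentric circles of strictly
decreasing radii in `(|s|, |s|⁻¹)`. -/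
theorem residue_integral_evaluation (q s : ℝ) (hq : q ∈ Set.Ioo (0 : ℝ) 1)
    (hs : s ∈ Set.Ioo (-1 : ℝ) 0) (l n : ℕ) (hl : 1 ≤ l) (hn : l ≤ n)
    (x : Fin l → ℕ) (hx1 : ∀ i, 1 ≤ x i) (hxdec : ∀ i j : Fin l, i ≤ j → x j ≤ x i)
    (σ : Fin l → Fin n) (hσ : Function.Injective σ)
    (r : Fin n → ℝ) (hr : StrictAnti r) (hr1 : ∀ i, |s| < r i) (hr2 : ∀ i, r i < |s|⁻¹)
    (lam : Sign n) :
    (1 / (2 * (Real.pi : ℂ) * Complex.I)) ^ n *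
      iterInt n (fun i => fun g => ∮ z in C(0, r i), g z)
        (fun u =>
          (∏ p ∈ (Finset.univ : Finset (Fin n × Fin n)).filter (fun p => p.1 < p.2),
            (u p.1 - u p.2) / (u p.1 - (q : ℂ) * u p.2)) *
          ResSig (q : ℂ) (s : ℂ) x σ u *
          ∏ i, (1 / (u i - (s : ℂ)) * ((1 - (s : ℂ) * u i) / (u i - (s : ℂ))) ^ (lam.1 i)))
      = (if ∀ i, x i - 1 ≤ lam.1 (σ i) then 1 else 0) * (-(s : ℂ)) ^ (∑ i, lam.1 i) *
          (q : ℂ) ^ (((Finset.univ : Finset (Fin l × Fin l)).filter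
            (fun p => p.1 < p.2 ∧ σ p.2 < σ p.1)).card) *
          (q : ℂ) ^ (∑ i, ((σ i : ℕ) + 1)) * (q : ℂ) ^ (-(l : ℤ)) * (1 - (q : ℂ)) ^ l := by
  obtain ⟨hq0, hq1⟩ := hq
  have hs0 : 0 < |s| := abs_pos.2 hs.2.ne
  have hsC : (s : ℂ) ≠ 0 := Complex.ofReal_ne_zero.2 hs.2.ne
  have hqn : ‖(q : ℂ)‖ ≤ 1 := by
    rw [Complex.norm_real, Real.norm_of_nonneg hq0.le]
    exact hq1.le
  have hR : ∀ i, 0 < r i := fun i => hs0.trans (hr1 i)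
  have hne : ∀ i (z : ℂ), r i ≤ ‖z‖ → z ≠ s := by
    rintro i z hz rfl
    rw [Complex.norm_real, Real.norm_eq_abs] at hz
    exact (hr1 i).not_ge hz
  have hne' : ∀ i (z : ℂ), ‖z‖ ≤ r i → z ≠ (s : ℂ)⁻¹ := by
    rintro i z hz rfl
    rw [norm_inv, Complex.norm_real, Real.norm_eq_abs] at hz
    exact (hr2 i).not_ge hz
  set e : Fin n → ℕ := Function.extend σ (fun i => x i - 1) 0
  set K := rankKernel (q : ℂ) (injRank σ) with hKdef
  set f : Fin n → ℂ → ℂ := fun j => reducedWeight s (e j) (lam.1 j)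
  have hK : ∀ i j, ∀ p : ℂ × ℂ, ‖p.2‖ < ‖p.1‖ →
      DifferentiableAt ℂ (fun p : ℂ × ℂ => K i j p.1 p.2) p :=
    fun i j p hp => differentiableAt_rankKernel hqn _ i j p hp
  have hfc : ∀ i, ContinuousOn (f i) (Metric.sphere 0 (r i)) := by
    intro i z hz
    have hz' : ‖z‖ = r i := mem_sphere_zero_iff_norm.1 hz
    rcases le_or_gt (e i) (lam.1 i) with h | h
    · exact (differentiableAt_reducedWeight_of_le h
        (hne i z hz'.ge)).continuousAt.continuousWithinAt
    · exact (differentiableAt_reducedWeight_of_lt h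
        (hne' i z hz'.le)).continuousAt.continuousWithinAt
  set F : (Fin n → ℂ) → ℂ := fun u =>
    ((1 - (q : ℂ)) ^ l * (q : ℂ) ^ (l * (l - 1) / 2)) * nestedProd K f u with hF
  have hcont := continuousOn_nestedProd hr hK hfc
  have heq : Set.EqOn (fun u : Fin n → ℂ =>
          (∏ p ∈ (Finset.univ : Finset (Fin n × Fin n)).filter (fun p => p.1 < p.2),
            (u p.1 - u p.2) / (u p.1 - (q : ℂ) * u p.2)) *
          ResSig (q : ℂ) (s : ℂ) x σ u *
          ∏ i, (1 / (u i - (s : ℂ)) * ((1 - (s : ℂ) * u i) / (u i - (s : ℂ))) ^ (lam.1 i)))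
      F (Set.pi Set.univ (fun i => Metric.sphere (0 : ℂ) (r i))) := by
    intro u hu
    have hnorm : ∀ i, ‖u i‖ = r i := fun i => by simpa using hu i (Set.mem_univ _)
    refine integrand_eq_nestedProd hsC hσ ?_ ?_ (fun i => hne i _ (hnorm i).ge)
      fun i => hne' i _ (hnorm i).le
    · intro i j hij h
      refine hij (hr.injective ?_)
      rw [← hnorm i, ← hnorm j, h]
    · intro i j hij h
      refine (hr hij).not_ge ?_
      rw [← hnorm i, ← hnorm j, h, norm_mul]
      exact mul_le_of_le_one_left (norm_nonneg _) hqn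
  rw [iterInt_circle_eq_torusIntegral hR
    ((continuousOn_const.mul hcont).congr heq), torusIntegral_congr hR heq, hF,
    torusIntegral_const_mul]
  have heσ : ∀ i, e (σ i) = x i - 1 := fun i => hσ.extend_apply _ _ _
  have he0 : ∀ j, j ∉ Finset.image σ Finset.univ → e j = 0 := fun j hj =>
    Function.extend_apply' _ _ _ (by simpa using hj)
  by_cases hall : ∀ i, x i - 1 ≤ lam.1 (σ i)
  · have hle : ∀ j, e j ≤ lam.1 j := by
      intro j
      by_cases hj : j ∈ Finset.image σ Finset.univ
      · obtain ⟨i, -, rfl⟩ := Finset.mem_image.1 hj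
        rw [heσ]
        exact hall i
      · rw [he0 j hj]
        exact Nat.zero_le _
    rw [if_pos hall, torusIntegral_nestedProd hR hr hK
      (fun i j y => tendsto_rankKernel (q : ℂ) (injRank σ) i j y)
      (fun i z hz => differentiableAt_reducedWeight_of_le (hle i) (hne i z hz))
      (fun i => tendsto_mul_reducedWeight (hle i)), Finset.prod_pow_eq_pow_sum]
    have hcount := prod_injRank_inversions hσ (q : ℂ)
    have hqC : (q : ℂ) ≠ 0 := Complex.ofReal_ne_zero.2 hq0.ne'
    have hpow : (q : ℂ) ^ (∑ i, ((σ i : ℕ) + 1)) * (q : ℂ) ^ (-(l : ℤ)) =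
        (q : ℂ) ^ (∑ i, (σ i : ℕ)) := by
      rw [Finset.sum_add_distrib, pow_add, zpow_neg, zpow_natCast]
      simp [hqC]
    have hpi : (1 / (2 * (Real.pi : ℂ) * Complex.I)) ^ n * (2 * Real.pi * Complex.I) ^ n = 1 := by
      rw [← mul_pow, one_div_mul_cancel Complex.two_pi_I_ne_zero, one_pow]
    calc _ = ((1 / (2 * (Real.pi : ℂ) * Complex.I)) ^ n * (2 * Real.pi * Complex.I) ^ n) *
          (1 - (q : ℂ)) ^ l * (-(s : ℂ)) ^ (∑ i, lam.1 i) * ((q : ℂ) ^ (l * (l - 1) / 2) *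
          (∏ i, ∏ j, if i < j then (if injRank σ j < injRank σ i then (q : ℂ) else 1) else 1)) := by
          ring
      _ = _ := by
          rw [hpi, hcount, mul_assoc _ _ ((q : ℂ) ^ (-(l : ℤ))), hpow]
          ring
  · rw [if_neg hall]
    push Not at hall
    obtain ⟨i₀, hi₀⟩ := hall
    obtain ⟨k, hk, hmax⟩ := (Finset.univ.filter fun j => lam.1 j < e j).exists_max_image id
      ⟨σ i₀, by simpa [heσ] using hi₀⟩
    rw [Finset.mem_filter] at hk
    have hkσ : k ∈ Finset.image σ Finset.univ := by
      by_contra h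
      have := hk.2
      rw [he0 k h] at this
      exact Nat.not_lt_zero _ this
    obtain ⟨a, -, rfl⟩ := Finset.mem_image.1 hkσ
    have hzero := torusIntegral_nestedProd_eq_zero hR hr hK hfc (σ a) (fun j hj => ?_)
      fun z hz => differentiableAt_reducedWeight_of_lt hk.2 (hne' _ z hz)
    · rw [hzero]
      simp
    · have hlt : injRank σ (σ a) < injRank σ j := by
        rw [injRank_apply hσ]
        by_cases hjσ : j ∈ Finset.image σ Finset.univ
        · obtain ⟨b, -, rfl⟩ := Finset.mem_image.1 hjσ
          rw [injRank_apply hσ]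
          by_contra! hba
          have h1 := hk.2
          have h2 := lam.2 _ _ hj.le
          have h3 := hxdec b a hba
          refine hj.not_ge (hmax (σ b) (Finset.mem_filter.2 ⟨Finset.mem_univ _, ?_⟩))
          rw [heσ] at h1 ⊢
          omega
        · rw [injRank_of_notMem hjσ]
          exact a.2
      simp [hKdef, rankKernel, hlt]

end
end
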